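/- arXiv:math/0208230 — 4 statements merged into one kernel-verified Lean document; each statement's English description precedes it below -/
import Mathlib

section
/- Let f: ℝ → ℝ be real and even, with Fourier transform f̂ continuous and supported in [−α, α] for some α > 0, and let m ≥ 1 be an integer with m < 2/α. Then, as q → ∞ through odd primes, ⟨(W_f^osc)^m⟩_q converges to 0 if m is odd, and to (m! / (2^{m/2} (m/2)!)) · σ(f)^m if m is even, where σ(f)² = ∫_{−1}^{1} |u| · f̂(u)² du. -/
open ArithmeticFunction Filter

/-- The oscillatory part of the linear statistic:
`W_f^osc(χ) = -(1/log q) ∑ₙ (Λ(n)/√n) f̂(log n/log q) (χ(n) + conj χ(n))`. -/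
noncomputable def Wosc (q : ℕ) (fhat : ℝ → ℝ) (χ : DirichletCharacter ℂ q) : ℝ :=
  -(1 / Real.log q) *
    ∑' n : ℕ, Λ n / Real.sqrt n * fhat (Real.log n / Real.log q) *
      (χ n + (starRingEnd ℂ) (χ n)).re

open scoped Classical in
/-- The average over the `q - 2` nontrivial Dirichlet characters modulo the prime `q`. -/
noncomputable def charAvg (q : ℕ) (H : DirichletCharacter ℂ q → ℝ) : ℝ :=
  (1 / (q - 2 : ℝ)) * ∑ χ ∈ Finset.univ.filter (fun χ : DirichletCharacter ℂ q => χ ≠ 1), H χ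

/-- The arithmetic function `f` vanishes at all integers larger than `X`. -/
def SuppLe (f : ArithmeticFunction ℝ) (X : ℝ) : Prop := ∀ n : ℕ, X < n → f n = 0

theorem SuppLe.mono {f : ArithmeticFunction ℝ} {X Y : ℝ} (hf : SuppLe f X) (h : X ≤ Y) :
    SuppLe f Y := fun n hn => hf n (h.trans_lt hn)

theorem SuppLe.mul {f g : ArithmeticFunction ℝ} {X Y : ℝ} (hf : SuppLe f X) (hg : SuppLe g Y)
    (hX : 0 ≤ X) : SuppLe (f * g) (X * Y) := by
  intro n hn
  rw [ArithmeticFunction.mul_apply]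
  refine Finset.sum_eq_zero fun x hx => ?_
  rw [Nat.mem_divisorsAntidiagonal] at hx
  by_cases h1 : X < x.1
  · simp [hf _ h1]
  · by_cases h2 : Y < x.2
    · simp [hg _ h2]
    · exfalso
      push Not at h1 h2
      have : (n : ℝ) ≤ X * Y := by
        rw [← hx.1]; push_cast
        exact mul_le_mul h1 h2 (by positivity) hX
      linarith

theorem SuppLe.one : SuppLe 1 1 := by
  intro n hn
  rw [ArithmeticFunction.one_apply_ne]
  rintro rfl
  simp at hn

theorem SuppLe.pow {f : ArithmeticFunction ℝ} {X : ℝ} (hf : SuppLe f X) (hX : 0 ≤ X) (k : ℕ) :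
    SuppLe (f ^ k) (X ^ k) := by
  induction k with
  | zero => simpa using SuppLe.one
  | succ k ih => rw [pow_succ, pow_succ]; exact ih.mul hf (by positivity)

theorem SuppLe.pmul {f : ArithmeticFunction ℝ} {X : ℝ} (hf : SuppLe f X)
    (g : ArithmeticFunction ℝ) : SuppLe (f.pmul g) X := fun n hn => by
  simp [ArithmeticFunction.pmul_apply, hf n hn]

theorem SuppLe.tsum_eq {A : Type*} [AddCommMonoid A] [TopologicalSpace A] [Module ℝ A]
    {f : ArithmeticFunction ℝ} {X : ℝ} (hf : SuppLe f X) (φ : ℕ → A) {M : ℕ} (hM : X ≤ M) :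
    ∑' n, f n • φ n = ∑ n ∈ Finset.Icc 1 M, f n • φ n := by
  refine tsum_eq_sum fun n hn => ?_
  rw [Finset.mem_Icc] at hn
  rcases Nat.eq_zero_or_pos n with rfl | h
  · simp
  · rw [hf n, zero_smul]
    have : M < n := by by_contra! h'; exact hn ⟨h, h'⟩
    exact hM.trans_lt (by exact_mod_cast this)

theorem SuppLe.summable {f : ArithmeticFunction ℝ} {X : ℝ} (hf : SuppLe f X) (φ : ℕ → ℝ) :
    Summable fun n => f n * φ n := by
  obtain ⟨M, hM⟩ := exists_nat_ge X
  refine summable_of_ne_finset_zero (s := Finset.range (M + 1)) fun n hn => ?_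
  rw [hf n, zero_mul]
  rw [Finset.mem_range] at hn
  exact hM.trans_lt (by exact_mod_cast (by omega : M < n))

theorem tsum_mul_smul {A : Type*} [CommRing A] [TopologicalSpace A] [Algebra ℝ A]
    {f g : ArithmeticFunction ℝ} {X Y : ℝ} (hf : SuppLe f X) (hg : SuppLe g Y)
    (φ : ℕ → A) (hφ : ∀ a b, φ (a * b) = φ a * φ b) :
    ∑' n, (f * g) n • φ n = (∑' n, f n • φ n) * ∑' n, g n • φ n := by
  obtain ⟨M, hM⟩ := exists_nat_ge X
  obtain ⟨N, hN⟩ := exists_nat_ge Y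
  rw [hf.tsum_eq φ hM, hg.tsum_eq φ hN, ((hf.mono hM).mul (hg.mono hN) (by positivity)).tsum_eq φ
    (M := M * N) (by push_cast; rfl), Finset.sum_mul_sum, ← Finset.sum_product',
    ← Finset.sum_fiberwise_of_maps_to (g := fun x : ℕ × ℕ => x.1 * x.2)
      (t := Finset.Icc 1 (M * N))]
  · refine Finset.sum_congr rfl fun n hn => ?_
    rw [Finset.mem_Icc] at hn
    rw [ArithmeticFunction.mul_apply, Finset.sum_smul]
    symm
    refine Finset.sum_subset_zero_on_sdiff (fun x hx => ?_) (fun x hx => ?_) (fun x hx => ?_)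
    · simp only [Finset.mem_filter] at hx
      exact Nat.mem_divisorsAntidiagonal.2 ⟨hx.2, by omega⟩
    · simp only [Finset.mem_sdiff, Nat.mem_divisorsAntidiagonal, Finset.mem_filter,
        Finset.mem_product, Finset.mem_Icc] at hx
      obtain ⟨⟨h1, h2⟩, h3⟩ := hx
      by_cases ha : x.1 ≤ M
      · by_cases hb : x.2 ≤ N
        · exfalso
          have ha' : x.1 ≠ 0 := by intro h; simp [h] at h1; omega
          have hb' : x.2 ≠ 0 := by intro h; simp [h] at h1; omega
          exact h3 ⟨⟨⟨by omega, ha⟩, ⟨by omega, hb⟩⟩, h1⟩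
        · rw [hg x.2 (hN.trans_lt (by exact_mod_cast (by omega : N < x.2))), mul_zero, zero_smul]
      · rw [hf x.1 (hM.trans_lt (by exact_mod_cast (by omega : M < x.1))), zero_mul, zero_smul]
    · simp only [Finset.mem_filter] at hx
      rw [← hx.2, hφ, smul_mul_smul_comm]
  · intro x hx
    simp only [Finset.mem_product, Finset.mem_Icc] at hx ⊢
    exact ⟨Nat.mul_pos hx.1.1 hx.2.1, Nat.mul_le_mul hx.1.2 hx.2.2⟩

theorem tsum_pow_smul {A : Type*} [CommRing A] [TopologicalSpace A] [T2Space A] [Algebra ℝ A]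
    {f : ArithmeticFunction ℝ} {X : ℝ} (hf : SuppLe f X) (hX : 0 ≤ X)
    (φ : ℕ → A) (hφ : ∀ a b, φ (a * b) = φ a * φ b) (h1 : φ 1 = 1) (k : ℕ) :
    ∑' n, (f ^ k) n • φ n = (∑' n, f n • φ n) ^ k := by
  induction k with
  | zero =>
    rw [pow_zero, pow_zero, tsum_eq_single 1]
    · simp [h1]
    · intro n hn; simp [hn]
  | succ k ih => rw [pow_succ, pow_succ, ← ih, tsum_mul_smul (hf.pow hX k) hf φ hφ]

/-- The standard inner product of two arithmetic functions. -/
noncomputable def pairing (f g : ArithmeticFunction ℝ) : ℝ := ∑' n, f n * g n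

theorem pairing_mul_mul {p : ℕ} (hp : p.Prime) {f g u v : ArithmeticFunction ℝ}
    (hf : ∀ n, p ∣ n → f n = 0) (hg : ∀ n, p ∣ n → g n = 0)
    (hu : ∀ n, (∀ c, n ≠ p ^ c) → u n = 0) (hv : ∀ n, (∀ c, n ≠ p ^ c) → v n = 0)
    {X Y : ℝ} (hfX : SuppLe f X) (huY : SuppLe u Y) :
    pairing (f * u) (g * v) = pairing f g * pairing u v := by
  have key : ∀ f u : ArithmeticFunction ℝ, (∀ n, p ∣ n → f n = 0) →
      (∀ n, (∀ c, n ≠ p ^ c) → u n = 0) → ∀ a b : ℕ, ¬ p ∣ b →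
      (f * u) (p ^ a * b) = f b * u (p ^ a) := by
    intro f u hf hu a b hb
    have hb0 : b ≠ 0 := by rintro rfl; simp at hb
    rw [ArithmeticFunction.mul_apply, Finset.sum_eq_single (b, p ^ a)]
    · rintro ⟨x, y⟩ hx hne
      rw [Nat.mem_divisorsAntidiagonal] at hx
      by_cases hpx : p ∣ x
      · simp [hf x hpx]
      by_cases hy : ∃ c, y = p ^ c
      · exfalso
        obtain ⟨c, rfl⟩ := hy
        simp only at hx
        have hcop : ∀ z, ¬ p ∣ z → ∀ k, Nat.Coprime (p ^ k) z := fun z hz k =>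
          Nat.Coprime.pow_left _ ((Nat.Prime.coprime_iff_not_dvd hp).2 hz)
        have h1 : p ^ c ∣ p ^ a := (hcop b hb c).dvd_of_dvd_mul_right (hx.1 ▸ dvd_mul_left _ _)
        have h2 : p ^ a ∣ p ^ c := (hcop x hpx a).dvd_of_dvd_mul_left (hx.1 ▸ dvd_mul_right _ _)
        have h3 := Nat.dvd_antisymm h1 h2
        apply hne
        rw [h3, mul_comm] at hx
        have := Nat.eq_of_mul_eq_mul_left (pow_pos hp.pos a) hx.1
        rw [this, h3]
      · push Not at hy
        simp [hu y hy]
    · intro h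
      exact absurd (Nat.mem_divisorsAntidiagonal.2 ⟨by ring, by
        have := hp.pos; positivity⟩) h
  have h := tsum_mul_smul (A := ℝ) (hfX.pmul g) (huY.pmul v) (fun _ => 1) (by simp)
  simp only [smul_eq_mul, mul_one, ArithmeticFunction.pmul_apply] at h
  rw [pairing, pairing, pairing, ← h]
  refine tsum_congr fun n => ?_
  rcases eq_or_ne n 0 with rfl | hn
  · simp
  obtain ⟨a, b, hb, rfl⟩ := Nat.exists_eq_pow_mul_and_not_dvd hn p hp.ne_one
  rw [key f u hf hu a b hb, key g v hg hv a b hb, key _ _ (fun n hn => by simp [hf n hn])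
    (fun n hn => by simp [hu n hn]) a b hb]
  simp only [ArithmeticFunction.pmul_apply]
  ring

theorem mul_eq_zero_of_dvd {p : ℕ} (hp : p.Prime) {f g : ArithmeticFunction ℝ}
    (hf : ∀ n, p ∣ n → f n = 0) (hg : ∀ n, p ∣ n → g n = 0) (n : ℕ) (hn : p ∣ n) :
    (f * g) n = 0 := by
  rw [ArithmeticFunction.mul_apply]
  refine Finset.sum_eq_zero fun x hx => ?_
  rw [Nat.mem_divisorsAntidiagonal] at hx
  rcases hp.dvd_mul.1 (hx.1 ▸ hn) with h | h
  · simp [hf _ h]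
  · simp [hg _ h]

theorem pow_eq_zero_of_dvd {p : ℕ} (hp : p.Prime) {f : ArithmeticFunction ℝ}
    (hf : ∀ n, p ∣ n → f n = 0) (k n : ℕ) (hn : p ∣ n) : (f ^ k) n = 0 := by
  induction k generalizing n with
  | zero =>
    rw [pow_zero, ArithmeticFunction.one_apply_ne]
    rintro rfl
    exact hp.one_lt.ne' (Nat.dvd_one.1 hn)
  | succ k ih => rw [pow_succ]; exact mul_eq_zero_of_dvd hp ih hf n hn

theorem pow_eq_zero_of_ne_prime_pow {p : ℕ} {f : ArithmeticFunction ℝ}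
    (hf : ∀ n, (∀ c, n ≠ p ^ c) → f n = 0) (k n : ℕ) (hn : ∀ c, n ≠ p ^ c) : (f ^ k) n = 0 := by
  induction k generalizing n with
  | zero =>
    rw [pow_zero, ArithmeticFunction.one_apply_ne]
    rintro rfl
    exact hn 0 (by simp)
  | succ k ih =>
    rw [pow_succ, ArithmeticFunction.mul_apply]
    refine Finset.sum_eq_zero fun x hx => ?_
    rw [Nat.mem_divisorsAntidiagonal] at hx
    by_cases h1 : ∃ c, x.1 = p ^ c
    · by_cases h2 : ∃ c, x.2 = p ^ c
      · obtain ⟨c, hc⟩ := h1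
        obtain ⟨d, hd⟩ := h2
        exact absurd (by rw [← hx.1, hc, hd, pow_add]) (hn (c + d))
      · push Not at h2; simp [hf _ h2]
    · push Not at h1; simp [ih _ h1]

theorem pairing_sum_sum {ι κ : Type*} (s : Finset ι) (t : Finset κ) (c : ι → ℝ) (d : κ → ℝ)
    (f : ι → ArithmeticFunction ℝ) (g : κ → ArithmeticFunction ℝ) {X : ℝ}
    (hf : ∀ i ∈ s, SuppLe (f i) X) (F G : ArithmeticFunction ℝ)
    (hF : ∀ n, F n = ∑ i ∈ s, c i * f i n) (hG : ∀ n, G n = ∑ j ∈ t, d j * g j n) :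
    pairing F G = ∑ i ∈ s, ∑ j ∈ t, c i * d j * pairing (f i) (g j) := by
  simp only [pairing, ← tsum_mul_left]
  rw [← Finset.sum_product']
  rw [← Summable.tsum_finsetSum]
  · refine tsum_congr fun n => ?_
    rw [hF, hG, Finset.sum_mul_sum, ← Finset.sum_product']
    exact Finset.sum_congr rfl fun x _ => by ring
  · rintro x hx
    exact ((hf x.1 (Finset.mem_product.1 hx).1).summable _).mul_left _

theorem pairing_add_pow {p : ℕ} (hp : p.Prime) {f u : ArithmeticFunction ℝ}
    (hf : ∀ n, p ∣ n → f n = 0) (hu : ∀ n, (∀ c, n ≠ p ^ c) → u n = 0)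
    {X : ℝ} (hX : 1 ≤ X) (hfX : SuppLe f X) (huX : SuppLe u X) (k l : ℕ) :
    pairing ((u + f) ^ k) ((u + f) ^ l) = ∑ i ∈ Finset.range (k + 1), ∑ j ∈ Finset.range (l + 1),
      ((k.choose i : ℝ) * (l.choose j : ℝ)) * (pairing (u ^ i) (u ^ j) *
        pairing (f ^ (k - i)) (f ^ (l - j))) := by
  have hX0 : 0 ≤ X := by linarith
  have ex : ∀ (k n : ℕ), ((u + f) ^ k) n =
      ∑ i ∈ Finset.range (k + 1), (k.choose i : ℝ) * (f ^ (k - i) * u ^ i) n := by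
    intro k n
    rw [add_pow]
    have : ∀ (s : Finset ℕ) (G : ℕ → ArithmeticFunction ℝ), (∑ i ∈ s, G i) n = ∑ i ∈ s, G i n := by
      intro s G
      classical
      induction s using Finset.induction_on with
      | empty => simp
      | insert a s ha ih => rw [Finset.sum_insert ha, Finset.sum_insert ha,
          ArithmeticFunction.add_apply, ih]
    rw [this]
    refine Finset.sum_congr rfl fun i _ => ?_
    rw [mul_comm (u ^ i), mul_comm, ← nsmul_eq_mul]
    induction (k.choose i) with
    | zero => simp
    | succ m ih => rw [succ_nsmul, ArithmeticFunction.add_apply, ih]; push_cast; ring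
  rw [pairing_sum_sum (Finset.range (k + 1)) (Finset.range (l + 1)) (fun i => (k.choose i : ℝ))
    (fun j => (l.choose j : ℝ)) (fun i => f ^ (k - i) * u ^ i) (fun j => f ^ (l - j) * u ^ j)
    (X := X ^ k) ?_ _ _ (ex k) (ex l)]
  · refine Finset.sum_congr rfl fun i _ => Finset.sum_congr rfl fun j _ => ?_
    rw [pairing_mul_mul hp (pow_eq_zero_of_dvd hp hf _) (pow_eq_zero_of_dvd hp hf _)
      (pow_eq_zero_of_ne_prime_pow hu _) (pow_eq_zero_of_ne_prime_pow hu _) (X := X ^ (k - i))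
      (hfX.pow hX0 _) (huX.pow hX0 _), mul_comm (pairing (u ^ i) (u ^ j))]
  · intro i hi
    have := (hfX.pow hX0 (k - i)).mul (huX.pow hX0 i) (by positivity)
    rwa [← pow_add, Nat.sub_add_cancel (by simpa [Nat.lt_succ_iff] using hi)] at this

theorem abs_add_pow_sub_le {B : ℝ} (hB : 1 ≤ B) (k : ℕ) : ∃ D : ℝ, 0 ≤ D ∧ ∀ S s : ℝ, 0 ≤ S →
    S ≤ B → 0 ≤ s → s ≤ B → |(S + s) ^ k - S ^ k - k * s * S ^ (k - 1)| ≤ D * s ^ 2 := by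
  induction k with
  | zero => exact ⟨0, le_rfl, by intros; simp⟩
  | succ k ih =>
    obtain ⟨D, hD, h⟩ := ih
    refine ⟨2 * B * D + k * B ^ (k - 1), by positivity, fun S s hS hSB hs hsB => ?_⟩
    have e : (S + s) ^ (k + 1) - S ^ (k + 1) - (k + 1 : ℕ) * s * S ^ (k + 1 - 1) =
        (S + s) * ((S + s) ^ k - S ^ k - k * s * S ^ (k - 1)) + k * S ^ (k - 1) * s ^ 2 := by
      rcases k with _ | k
      · simp
      · simp only [Nat.add_sub_cancel]; push_cast; ring
    rw [e]
    refine (abs_add_le _ _).trans ?_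
    rw [abs_mul, abs_of_nonneg (by positivity : 0 ≤ S + s),
      abs_of_nonneg (by positivity : 0 ≤ k * S ^ (k - 1) * s ^ 2), add_mul (2 * B * D)]
    refine add_le_add ?_ (by gcongr)
    calc (S + s) * _ ≤ (2 * B) * (D * s ^ 2) :=
          mul_le_mul (by linarith) (h S s hS hSB hs hsB) (abs_nonneg _) (by positivity)
      _ = _ := by ring

/-- The mixed moments `E[Z ^ k * conj Z ^ l]` of a complex Gaussian of variance `S`. -/
noncomputable def gaussMoment (S : ℝ) (k l : ℕ) : ℝ := if k = l then (k.factorial : ℝ) * S ^ k else 0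

/-- Mixed moments of sums of independent centred rotation-invariant summands `p`, described by
the binomial rule for adding a summand. -/
structure MomentFamily (P₀ : Finset ℕ) (n : ℕ) (c : ℝ) (s e : ℕ → ℝ) (μ : ℕ → ℕ → ℕ → ℝ)
    (M : Finset ℕ → ℕ → ℕ → ℝ) : Prop where
  empty : ∀ k l, M ∅ k l = if k = 0 ∧ l = 0 then 1 else 0
  insert_eq : ∀ P p, p ∉ P → insert p P ⊆ P₀ → ∀ k l, M (insert p P) k l =
    ∑ i ∈ Finset.range (k + 1), ∑ j ∈ Finset.range (l + 1),
      ((k.choose i : ℝ) * (l.choose j : ℝ)) * (μ p i j * M P (k - i) (l - j))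
  zero_zero : ∀ p ∈ P₀, μ p 0 0 = 1
  succ_zero : ∀ p ∈ P₀, ∀ i, μ p (i + 1) 0 = 0
  zero_succ : ∀ p ∈ P₀, ∀ j, μ p 0 (j + 1) = 0
  one_one : ∀ p ∈ P₀, μ p 1 1 = s p
  s_nonneg : ∀ p ∈ P₀, 0 ≤ s p
  e_nonneg : ∀ p ∈ P₀, 0 ≤ e p
  bound : ∀ p ∈ P₀, ∀ i j, 1 ≤ i → 1 ≤ j → 3 ≤ i + j → i ≤ n → j ≤ n → |μ p i j| ≤ c * e p

theorem MomentFamily.step {P₀ : Finset ℕ} {n : ℕ} {c : ℝ} (hc : 0 ≤ c) {s e : ℕ → ℝ}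
    {μ : ℕ → ℕ → ℕ → ℝ} {M : Finset ℕ → ℕ → ℕ → ℝ} (h : MomentFamily P₀ n c s e μ M)
    {P : Finset ℕ} {p : ℕ} (hpP : p ∉ P) (hP : insert p P ⊆ P₀) {k l : ℕ} (hk : k ≤ n)
    (hl : l ≤ n) {H : ℝ} (hH : 0 ≤ H) (hM : ∀ k' < k, ∀ l' ≤ n, |M P k' l'| ≤ H) :
    |M (insert p P) k l - M P k l - k * l * s p * M P (k - 1) (l - 1)| ≤
      (n + 1) ^ 2 * (2 ^ n * 2 ^ n * (c * H)) * e p := by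
  have hp : p ∈ P₀ := hP (Finset.mem_insert_self p P)
  have e0 := h.e_nonneg p hp
  have h1 : M P k l = ∑ i ∈ Finset.range (k + 1), ∑ j ∈ Finset.range (l + 1),
      if i = 0 ∧ j = 0 then M P k l else 0 := by
    rw [Finset.sum_eq_single 0, Finset.sum_eq_single 0]
    · simp
    · intro j _ hj; simp [hj]
    · simp
    · intro i _ hi; simp [hi]
    · simp
  have h2 : k * l * s p * M P (k - 1) (l - 1) =
      ∑ i ∈ Finset.range (k + 1), ∑ j ∈ Finset.range (l + 1),
      if i = 1 ∧ j = 1 then k * l * s p * M P (k - 1) (l - 1) else 0 := by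
    rw [Finset.sum_eq_single 1, Finset.sum_eq_single 1]
    · simp
    · intro j _ hj; simp [hj]
    · intro hl
      have : l = 0 := by simpa using hl
      simp [this]
    · intro i _ hi; simp [hi]
    · intro hk
      have : k = 0 := by simpa using hk
      simp [this]
  rw [h.insert_eq P p hpP hP]
  conv_lhs => rw [h1, h2]
  simp only [← Finset.sum_sub_distrib]
  have hterm : ∀ i ∈ Finset.range (k + 1), ∀ j ∈ Finset.range (l + 1),
      |((k.choose i : ℝ) * (l.choose j : ℝ)) * (μ p i j * M P (k - i) (l - j)) -
        (if i = 0 ∧ j = 0 then M P k l else 0) -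
        (if i = 1 ∧ j = 1 then k * l * s p * M P (k - 1) (l - 1) else 0)| ≤
      2 ^ n * 2 ^ n * (c * H) * e p := by
    intro i hi j hj
    have hi' : i ≤ k := by simpa [Nat.lt_succ_iff] using hi
    have hj' : j ≤ l := by simpa [Nat.lt_succ_iff] using hj
    have hpos : 0 ≤ 2 ^ n * 2 ^ n * (c * H) * e p := by positivity
    rcases i with _ | i
    · rcases j with _ | j
      · simpa [h.zero_zero p hp] using hpos
      · simpa [h.zero_succ p hp] using hpos
    · rcases j with _ | j
      · simpa [h.succ_zero p hp] using hpos
      · by_cases hij : i = 0 ∧ j = 0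
        · obtain ⟨rfl, rfl⟩ := hij
          have : (k : ℝ) * l * (s p * M P (k - 1) (l - 1)) -
            k * l * s p * M P (k - 1) (l - 1) = 0 := by ring
          simpa [h.one_one p hp, this] using hpos
        · have : ¬ (i + 1 = 1 ∧ j + 1 = 1) := by omega
          rw [if_neg this, if_neg (by omega), sub_zero, sub_zero, abs_mul,
            abs_of_nonneg (by positivity : 0 ≤ (k.choose (i + 1) : ℝ) * (l.choose (j + 1) : ℝ)), abs_mul]
          have b1 : (k.choose (i + 1) : ℝ) ≤ 2 ^ n := by
            exact_mod_cast (Nat.choose_le_two_pow k (i + 1)).trans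
              (Nat.pow_le_pow_right (by norm_num) hk)
          have b2 : (l.choose (j + 1) : ℝ) ≤ 2 ^ n := by
            exact_mod_cast (Nat.choose_le_two_pow l (j + 1)).trans
              (Nat.pow_le_pow_right (by norm_num) hl)
          have b3 := h.bound p hp (i + 1) (j + 1) (by omega) (by omega) (by omega) (by omega)
            (by omega)
          have b4 := hM (k - (i + 1)) (by omega) (l - (j + 1)) (by omega)
          calc _ ≤ (2 ^ n * 2 ^ n) * (c * e p * H) := by gcongr
            _ = _ := by ring
  calc _ ≤ ∑ i ∈ Finset.range (k + 1), ∑ j ∈ Finset.range (l + 1),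
        2 ^ n * 2 ^ n * (c * H) * e p :=
        (Finset.abs_sum_le_sum_abs _ _).trans (Finset.sum_le_sum fun i hi =>
          (Finset.abs_sum_le_sum_abs _ _).trans (Finset.sum_le_sum fun j hj => hterm i hi j hj))
    _ = ((k + 1) * (l + 1)) * (2 ^ n * 2 ^ n * (c * H) * e p) := by
        simp; ring
    _ ≤ ((n + 1) * (n + 1)) * (2 ^ n * 2 ^ n * (c * H) * e p) := by
        gcongr
    _ = _ := by ring

theorem gaussMoment_step {B : ℝ} (hB : 1 ≤ B) (n : ℕ) : ∃ D : ℝ, 0 ≤ D ∧ ∀ k ≤ n, ∀ l ≤ n,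
    ∀ S s : ℝ, 0 ≤ S → S ≤ B → 0 ≤ s → s ≤ B →
    |gaussMoment (S + s) k l - gaussMoment S k l - k * l * s * gaussMoment S (k - 1) (l - 1)| ≤
      D * s ^ 2 := by
  choose D hD0 hD using abs_add_pow_sub_le hB
  refine ⟨∑ k ∈ Finset.range (n + 1), k.factorial * D k,
    Finset.sum_nonneg fun k _ => mul_nonneg (by positivity) (hD0 k), ?_⟩
  intro k hk l hl S s hS hSB hs hsB
  have hsum : (k.factorial : ℝ) * D k ≤ ∑ k ∈ Finset.range (n + 1), k.factorial * D k :=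
    Finset.single_le_sum (f := fun k : ℕ => (k.factorial : ℝ) * D k)
      (fun k _ => mul_nonneg (by positivity) (hD0 k)) (Finset.mem_range.2 (by omega))
  have hpos : 0 ≤ ∑ k ∈ Finset.range (n + 1), (k.factorial : ℝ) * D k :=
    le_trans (mul_nonneg (by positivity) (hD0 k)) hsum
  by_cases hkl : k = l
  · subst hkl
    have : gaussMoment (S + s) k k - gaussMoment S k k -
        k * k * s * gaussMoment S (k - 1) (k - 1) =
        k.factorial * ((S + s) ^ k - S ^ k - k * s * S ^ (k - 1)) := by
      simp only [gaussMoment, if_true]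
      rcases k with _ | k
      · simp
      · rw [Nat.add_sub_cancel, Nat.factorial_succ]; push_cast; ring
    rw [this, abs_mul, abs_of_nonneg (by positivity : (0 : ℝ) ≤ k.factorial)]
    calc _ ≤ (k.factorial : ℝ) * (D k * s ^ 2) := by gcongr; exact hD k S s hS hSB hs hsB
      _ = (k.factorial * D k) * s ^ 2 := by ring
      _ ≤ _ := by gcongr
  · have : (k : ℝ) * l * s * gaussMoment S (k - 1) (l - 1) = 0 := by
      rcases k with _ | k
      · simp
      rcases l with _ | l
      · simp
      · simp only [gaussMoment, Nat.add_sub_cancel]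
        rw [if_neg (by omega), mul_zero]
    rw [this]
    simp only [gaussMoment, if_neg hkl]
    simpa using mul_nonneg hpos (sq_nonneg s)

theorem MomentFamily.exists_bound {B c : ℝ} (hB : 1 ≤ B) (hc : 0 ≤ c) (n : ℕ) (k : ℕ) (hk : k ≤ n) :
    ∃ K : ℝ, 0 ≤ K ∧ ∀ k' ≤ k, ∀ (P₀ : Finset ℕ) (s e : ℕ → ℝ) (μ : ℕ → ℕ → ℕ → ℝ)
    (M : Finset ℕ → ℕ → ℕ → ℝ) (T : ℝ), MomentFamily P₀ n c s e μ M → ∑ p ∈ P₀, s p ≤ B →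
    ∑ p ∈ P₀, (s p ^ 2 + e p) ≤ T → T ≤ 1 → ∀ P ⊆ P₀, ∀ l ≤ n,
    |M P k' l - gaussMoment (∑ p ∈ P, s p) k' l| ≤ K * T := by
  obtain ⟨D, hD0, hD⟩ := gaussMoment_step hB n
  have main : ∀ k ≤ n, ∀ K : ℝ, 0 ≤ K → ∃ K' : ℝ, 0 ≤ K' ∧ ∀ (P₀ : Finset ℕ) (s e : ℕ → ℝ)
      (μ : ℕ → ℕ → ℕ → ℝ)
      (M : Finset ℕ → ℕ → ℕ → ℝ) (T : ℝ), MomentFamily P₀ n c s e μ M → ∑ p ∈ P₀, s p ≤ B →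
      ∑ p ∈ P₀, (s p ^ 2 + e p) ≤ T → T ≤ 1 →
      (∀ k' < k, ∀ P ⊆ P₀, ∀ l ≤ n, |M P k' l - gaussMoment (∑ p ∈ P, s p) k' l| ≤ K * T) →
      ∀ P ⊆ P₀, ∀ l ≤ n, |M P k l - gaussMoment (∑ p ∈ P, s p) k l| ≤ K' * T := by
    intro k hk K hK
    set H : ℝ := K + n.factorial * B ^ n with hH
    have hH0 : 0 ≤ H := by positivity
    set E : ℝ := (n + 1) ^ 2 * (2 ^ n * 2 ^ n * (c * H)) with hE
    have hE0 : 0 ≤ E := by positivity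
    refine ⟨n * n * K * B + (E + D), by positivity, ?_⟩
    intro P₀ s e μ M T h hSB hT hT1 ih P hP l hl
    have hT0 : 0 ≤ T := le_trans (Finset.sum_nonneg fun p hp =>
      add_nonneg (sq_nonneg _) (h.e_nonneg p hp)) hT
    have hSle : ∀ P ⊆ P₀, ∑ p ∈ P, s p ≤ B := fun P hP =>
      (Finset.sum_le_sum_of_subset_of_nonneg hP fun p hp _ => h.s_nonneg p hp).trans hSB
    have hSnn : ∀ P ⊆ P₀, 0 ≤ ∑ p ∈ P, s p := fun P hP =>
      Finset.sum_nonneg fun p hp => h.s_nonneg p (hP hp)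
    have claim : ∀ P ⊆ P₀, |M P k l - gaussMoment (∑ p ∈ P, s p) k l| ≤
        ∑ p ∈ P, (n * n * (K * T) * s p + (E + D) * (s p ^ 2 + e p)) := by
      intro P
      induction P using Finset.induction_on with
      | empty =>
        intro _
        rw [h.empty]
        simp only [gaussMoment, Finset.sum_empty]
        rcases k with _ | k
        · rcases l with _ | l <;> simp
        · simp
      | insert p P hpP ihP =>
        intro hP
        have hPP : P ⊆ P₀ := (Finset.subset_insert p P).trans hP
        have hp : p ∈ P₀ := hP (Finset.mem_insert_self p P)
        have hs0 := h.s_nonneg p hp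
        have he0 := h.e_nonneg p hp
        have hsB : s p ≤ B := by simpa using hSle {p} (by simpa using hp)
        have i1 := ihP hPP
        have i2 := h.step hc hpP hP hk hl hH0 (fun k' hk' l' hl' => by
          have a1 := ih k' hk' P hPP l' hl'
          have a2 : |gaussMoment (∑ p ∈ P, s p) k' l'| ≤ n.factorial * B ^ n := by
            unfold gaussMoment
            split_ifs with hkl
            · have := hSnn P hPP
              rw [abs_of_nonneg (by positivity)]
              have hk'n : k' ≤ n := by omega
              calc _ ≤ (n.factorial : ℝ) * B ^ k' := by
                    gcongr
                    exact hSle P hPP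
                _ ≤ _ := by gcongr
            · simp; positivity
          calc |M P k' l'| = |(M P k' l' - gaussMoment (∑ p ∈ P, s p) k' l') +
                gaussMoment (∑ p ∈ P, s p) k' l'| := by ring_nf
            _ ≤ K * T + n.factorial * B ^ n := (abs_add_le _ _).trans (add_le_add a1 a2)
            _ ≤ K * 1 + n.factorial * B ^ n := by gcongr
            _ = H := by rw [hH]; ring)
        have i3 := hD k hk l hl (∑ p ∈ P, s p) (s p) (hSnn P hPP) (hSle P hPP) hs0 hsB
        have i4 : |k * l * s p * (M P (k - 1) (l - 1) -
            gaussMoment (∑ p ∈ P, s p) (k - 1) (l - 1))| ≤ n * n * (K * T) * s p := by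
          rcases Nat.eq_zero_or_pos k with hk0 | hk0
          · rw [hk0]; simp; positivity
          · rw [abs_mul, abs_of_nonneg (by positivity)]
            have := ih (k - 1) (by omega) P hPP (l - 1) (by omega)
            calc _ ≤ (n : ℝ) * n * s p * (K * T) := by gcongr
              _ = _ := by ring
        rw [Finset.sum_insert hpP, Finset.sum_insert hpP, add_comm (s p)]
        have e1 : M (insert p P) k l - gaussMoment (∑ p ∈ P, s p + s p) k l =
          (M (insert p P) k l - M P k l - k * l * s p * M P (k - 1) (l - 1)) +
          (M P k l - gaussMoment (∑ p ∈ P, s p) k l) -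
          (gaussMoment (∑ p ∈ P, s p + s p) k l - gaussMoment (∑ p ∈ P, s p) k l -
            k * l * s p * gaussMoment (∑ p ∈ P, s p) (k - 1) (l - 1)) +
          k * l * s p * (M P (k - 1) (l - 1) -
            gaussMoment (∑ p ∈ P, s p) (k - 1) (l - 1)) := by ring
        rw [e1]
        refine (abs_add_le _ _).trans ?_
        have t1 := (abs_sub _ _).trans (add_le_add ((abs_add_le _ _).trans (add_le_add i2 i1)) i3)
        have t2 : E * e p + D * s p ^ 2 ≤ (E + D) * (s p ^ 2 + e p) := by
          nlinarith [mul_nonneg hE0 (sq_nonneg (s p)), mul_nonneg hD0 he0]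
        linarith
    refine (claim P hP).trans ?_
    rw [Finset.sum_add_distrib, ← Finset.mul_sum, ← Finset.mul_sum]
    have hT' : ∑ p ∈ P, (s p ^ 2 + e p) ≤ T :=
      (Finset.sum_le_sum_of_subset_of_nonneg hP fun p hp _ =>
        add_nonneg (sq_nonneg _) (h.e_nonneg p hp)).trans hT
    calc _ ≤ n * n * (K * T) * B + (E + D) * T := by
          gcongr
          exact hSle P hP
      _ = _ := by ring
  induction k with
  | zero =>
    obtain ⟨K, hK0, hK⟩ := main 0 (Nat.zero_le _) 0 le_rfl
    refine ⟨K, hK0, fun k' hk' P₀ s e μ M T h hS hT hT1 P hP l hl => ?_⟩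
    obtain rfl : k' = 0 := by omega
    exact hK P₀ s e μ M T h hS hT hT1 (by simp) P hP l hl
  | succ k ih =>
    obtain ⟨K, hK0, hK⟩ := ih (by omega)
    obtain ⟨K', hK'0, hK'⟩ := main (k + 1) hk K hK0
    refine ⟨max K K', le_max_of_le_left hK0, fun k' hk' P₀ s e μ M T h hS hT hT1 P hP l hl => ?_⟩
    have hT0 : 0 ≤ T := le_trans (Finset.sum_nonneg fun p hp =>
      add_nonneg (sq_nonneg _) (h.e_nonneg p hp)) hT
    rcases Nat.lt_or_ge k k' with hlt | hle
    · obtain rfl : k' = k + 1 := by omega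
      exact (hK' P₀ s e μ M T h hS hT hT1 (fun k' hk' P hP l hl =>
        hK k' (by omega) P₀ s e μ M T h hS hT hT1 P hP l hl) P hP l hl).trans
        (mul_le_mul_of_nonneg_right (le_max_right _ _) hT0)
    · exact (hK k' hle P₀ s e μ M T h hS hT hT1 P hP l hl).trans
        (mul_le_mul_of_nonneg_right (le_max_left _ _) hT0)

theorem abs_sum_vonMangoldt_div_sub_log_le {N : ℕ} (hN : 1 ≤ N) :
    |∑ n ∈ Finset.Icc 1 N, Λ n / n - Real.log N| ≤ Real.log 4 + 4 := by
  have hI : Finset.Icc 1 N = Finset.Ioc 0 N := by ext; simp; omega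
  have hN0 : (0 : ℝ) < N := by exact_mod_cast hN
  have hfac : ∀ N : ℕ, ∑ n ∈ Finset.Ioc 0 N, Real.log n = Real.log (N.factorial) := by
    intro N
    induction N with
    | zero => simp
    | succ N ih =>
      rw [Finset.sum_Ioc_succ_top (Nat.zero_le _), ih, Nat.factorial_succ, Nat.cast_mul,
        Real.log_mul (by positivity) (by positivity), add_comm]
  have hsum : ∑ n ∈ Finset.Ioc 0 N, Λ n * ((N / n : ℕ) : ℝ) = Real.log N.factorial := by
    rw [← sum_Ioc_mul_zeta_eq_sum, ← hfac, vonMangoldt_mul_zeta]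
    simp [ArithmeticFunction.log_apply]
  have hlow : N * Real.log N - N ≤ Real.log N.factorial := by
    have := Stirling.le_log_factorial_stirling (n := N) (by omega)
    have h1 : 0 ≤ Real.log N := Real.log_natCast_nonneg N
    have h2 : 0 ≤ Real.log (2 * Real.pi) := Real.log_nonneg (by linarith [Real.pi_gt_three])
    linarith
  have hup : Real.log N.factorial ≤ N * Real.log N := by
    rw [← hfac]
    calc _ ≤ ∑ n ∈ Finset.Ioc 0 N, Real.log N := by
          refine Finset.sum_le_sum fun n hn => ?_
          rw [Finset.mem_Ioc] at hn
          exact Real.log_le_log (by exact_mod_cast hn.1) (by exact_mod_cast hn.2)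
      _ = _ := by simp
  have hpsi : ∑ n ∈ Finset.Ioc 0 N, Λ n ≤ (Real.log 4 + 4) * N := by
    have := Chebyshev.psi_le_const_mul_self hN0.le
    rwa [Chebyshev.psi, Nat.floor_natCast] at this
  rw [hI]
  have e : N * ∑ n ∈ Finset.Ioc 0 N, Λ n / n = ∑ n ∈ Finset.Ioc 0 N, Λ n * ((N : ℝ) / n) := by
    rw [Finset.mul_sum]; exact Finset.sum_congr rfl fun n _ => by ring
  have l1 : ∑ n ∈ Finset.Ioc 0 N, Λ n * ((N / n : ℕ) : ℝ) ≤
      ∑ n ∈ Finset.Ioc 0 N, Λ n * ((N : ℝ) / n) :=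
    Finset.sum_le_sum fun n _ => mul_le_mul_of_nonneg_left Nat.cast_div_le vonMangoldt_nonneg
  have l2 : ∑ n ∈ Finset.Ioc 0 N, Λ n * ((N : ℝ) / n) ≤
      ∑ n ∈ Finset.Ioc 0 N, Λ n * ((N / n : ℕ) : ℝ) + ∑ n ∈ Finset.Ioc 0 N, Λ n := by
    rw [← Finset.sum_add_distrib]
    refine Finset.sum_le_sum fun n hn => ?_
    rw [← mul_add_one]
    refine mul_le_mul_of_nonneg_left ?_ vonMangoldt_nonneg
    rw [← Nat.floor_div_eq_div (K := ℝ)]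
    exact (Nat.lt_floor_add_one _).le
  have h4 : 0 ≤ Real.log 4 := Real.log_nonneg (by norm_num)
  rw [abs_le]
  constructor
  · have : N * (Real.log N - 1) ≤ N * ∑ n ∈ Finset.Ioc 0 N, Λ n / n := by rw [e]; linarith
    have := le_of_mul_le_mul_left this hN0
    linarith
  · have : N * ∑ n ∈ Finset.Ioc 0 N, Λ n / n ≤ N * (Real.log N + (Real.log 4 + 4)) := by
      rw [e]; linarith
    have := le_of_mul_le_mul_left this hN0
    linarith

theorem tendsto_sum_of_tendsto_cdf {ι : Type*} {l : Filter ι} (s : ι → Finset ℕ)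
    (a x : ι → ℕ → ℝ) (ha : ∀ i n, 0 ≤ a i n)
    (hx : ∀ i, ∀ n ∈ s i, a i n ≠ 0 → 0 < x i n ∧ x i n ≤ 1)
    (hF : ∀ t, 0 ≤ t → t ≤ 1 →
      Tendsto (fun i => ∑ n ∈ s i, if x i n ≤ t then a i n else 0) l (nhds t))
    {h : ℝ → ℝ} (hh : Continuous h) :
    Tendsto (fun i => ∑ n ∈ s i, a i n * h (x i n)) l (nhds (∫ u in (0 : ℝ)..1, h u)) := by
  rw [Metric.tendsto_nhds]
  intro ε hε
  set η := ε / 5 with hη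
  have hη0 : 0 < η := by positivity
  obtain ⟨δ, hδ, hδh⟩ := Metric.uniformContinuousOn_iff.1
    (isCompact_Icc.uniformContinuousOn_of_continuous (s := Set.Icc (0 : ℝ) 1) hh.continuousOn) η hη0
  obtain ⟨K, hK⟩ := exists_nat_one_div_lt hδ
  set N := K + 1 with hN
  have hN0 : (0 : ℝ) < N := by positivity
  have hKδ : 1 / (N : ℝ) < δ := by simpa [hN] using hK
  have mem : ∀ j ∈ Finset.range N, (j : ℝ) / N ∈ Set.Icc (0 : ℝ) 1 := by
    intro j hj
    refine ⟨by positivity, (div_le_one hN0).2 ?_⟩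
    exact_mod_cast (Finset.mem_range.1 hj).le
  have near : ∀ j ∈ Finset.range N, ∀ u, (j : ℝ) / N ≤ u → u ≤ ((j + 1 : ℕ) : ℝ) / N →
      |h u - h (j / N)| ≤ η := by
    intro j hj u h1 h2
    have h3 : ((j + 1 : ℕ) : ℝ) / N ≤ 1 := (div_le_one hN0).2 (by
      exact_mod_cast (Finset.mem_range.1 hj))
    have h4 : ((j + 1 : ℕ) : ℝ) / N = j / N + 1 / N := by push_cast; ring
    have := hδh u ⟨(mem j hj).1.trans h1, h2.trans h3⟩ (j / N) (mem j hj) (by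
      rw [Real.dist_eq, abs_of_nonneg (by linarith)]; linarith)
    rw [Real.dist_eq] at this
    exact this.le
  have int : |∑ j ∈ Finset.range N, (((j + 1 : ℕ) : ℝ) / N - j / N) * h (j / N) -
      ∫ u in (0 : ℝ)..1, h u| ≤ η := by
    have e1 : ∫ u in (0 : ℝ)..1, h u =
        ∑ j ∈ Finset.range N, ∫ u in ((j : ℝ) / N)..(((j + 1 : ℕ) : ℝ) / N), h u := by
      rw [intervalIntegral.sum_integral_adjacent_intervals (a := fun j : ℕ => (j : ℝ) / N)
        (fun k _ => hh.intervalIntegrable _ _)]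
      simp [hN0.ne']
    rw [e1, ← Finset.sum_sub_distrib]
    calc _ ≤ ∑ j ∈ Finset.range N, η * (1 / N) := by
          refine (Finset.abs_sum_le_sum_abs _ _).trans (Finset.sum_le_sum fun j hj => ?_)
          have h4 : ((j + 1 : ℕ) : ℝ) / N = j / N + 1 / N := by push_cast; ring
          have e2 : (((j + 1 : ℕ) : ℝ) / N - j / N) * h (j / N) =
              ∫ u in ((j : ℝ) / N)..(((j + 1 : ℕ) : ℝ) / N), h (j / N) := by simp
          rw [e2, ← intervalIntegral.integral_sub (by simp) (hh.intervalIntegrable _ _)]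
          have hle : (j : ℝ) / N ≤ ((j + 1 : ℕ) : ℝ) / N := by
            rw [h4]; linarith [one_div_pos.2 hN0]
          have := intervalIntegral.norm_integral_le_of_norm_le_const (C := η)
            (f := fun u => h (j / N) - h u) (a := (j : ℝ) / N) (b := ((j + 1 : ℕ) : ℝ) / N) (by
              intro u hu
              rw [Set.uIoc_of_le hle] at hu
              rw [Real.norm_eq_abs, abs_sub_comm]
              exact near j hj u hu.1.le hu.2)
          rw [Real.norm_eq_abs] at this
          refine this.trans_eq ?_
          rw [h4, add_sub_cancel_left, abs_of_pos (by positivity)]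
      _ = η := by simp; field_simp
  have lim := tendsto_finsetSum (Finset.range N) (fun j hj =>
    ((hF (((j + 1 : ℕ) : ℝ) / N) (by positivity) ((div_le_one hN0).2 (by
      exact_mod_cast (Finset.mem_range.1 hj)))).sub
      (hF ((j : ℝ) / N) (mem j hj).1 (mem j hj).2)).mul_const (h (j / N)))
  filter_upwards [(Metric.tendsto_nhds.1 lim) η hη0,
    (hF 1 zero_le_one le_rfl).eventually_lt_const (by norm_num : (1 : ℝ) < 2)] with i hi1 hi2
  rw [Real.dist_eq] at hi1 ⊢
  have step : |∑ n ∈ s i, a i n * h (x i n) - ∑ j ∈ Finset.range N,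
      ((∑ n ∈ s i, if x i n ≤ ((j + 1 : ℕ) : ℝ) / N then a i n else 0) -
        ∑ n ∈ s i, if x i n ≤ (j : ℝ) / N then a i n else 0) * h (j / N)| ≤ η * 2 := by
    simp only [← Finset.sum_sub_distrib, Finset.sum_mul]
    rw [Finset.sum_comm, ← Finset.sum_sub_distrib]
    calc _ ≤ ∑ n ∈ s i, η * (if x i n ≤ 1 then a i n else 0) := by
          refine (Finset.abs_sum_le_sum_abs _ _).trans (Finset.sum_le_sum fun n hn => ?_)
          by_cases han : a i n = 0
          · simp [han]
          obtain ⟨hx0, hx1⟩ := hx i n hn han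
          rw [if_pos hx1]
          have hNx : 0 < N * x i n := by positivity
          obtain ⟨j, hj⟩ : ∃ j, ⌈(N : ℝ) * x i n⌉₊ = j + 1 :=
            Nat.exists_eq_succ_of_ne_zero (Nat.ceil_pos.2 hNx).ne'
          have hj1 : (j : ℝ) / N < x i n := by
            rw [div_lt_iff₀ hN0, mul_comm]
            exact Nat.lt_ceil.1 (by omega)
          have hj2 : x i n ≤ ((j + 1 : ℕ) : ℝ) / N := by
            rw [le_div_iff₀ hN0, mul_comm, ← hj]
            exact Nat.le_ceil _
          have hjN : j ∈ Finset.range N := by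
            rw [Finset.mem_range]
            have : ⌈(N : ℝ) * x i n⌉₊ ≤ N := Nat.ceil_le.2 (by nlinarith)
            omega
          rw [Finset.sum_eq_single j]
          · rw [if_pos hj2, if_neg (not_le.2 hj1), sub_zero, ← mul_sub, abs_mul,
              abs_of_nonneg (ha i n), mul_comm]
            exact mul_le_mul_of_nonneg_right (near j hjN _ hj1.le hj2) (ha i n)
          · intro k _ hk
            rcases lt_or_gt_of_ne hk with hk | hk
            · have : ((k + 1 : ℕ) : ℝ) / N ≤ j / N := by
                gcongr; exact_mod_cast hk
              rw [if_neg (not_le.2 (this.trans_lt hj1)), if_neg (not_le.2 (lt_of_le_of_lt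
                (by gcongr) hj1))]
              simp
            · have : ((j + 1 : ℕ) : ℝ) / N ≤ k / N := by
                gcongr; exact_mod_cast hk
              rw [if_pos (hj2.trans this), if_pos (hj2.trans (this.trans (by gcongr; simp)))]
              simp
          · intro h; exact absurd hjN h
      _ = η * ∑ n ∈ s i, (if x i n ≤ 1 then a i n else 0) := by rw [Finset.mul_sum]
      _ ≤ η * 2 := by gcongr
  have t1 := abs_sub_le (∑ n ∈ s i, a i n * h (x i n)) _ (∫ u in (0 : ℝ)..1, h u) |>.trans
    (add_le_add step ((abs_sub_le _ _ _).trans (add_le_add hi1.le int)))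
  refine lt_of_le_of_lt t1 ?_
  rw [hη]; linarith

theorem tendsto_vonMangoldt_riemann_sum {h : ℝ → ℝ} (hh : Continuous h) :
    Tendsto (fun q : ℕ => ∑ n ∈ Finset.Icc 1 q, Λ n / n / Real.log q *
      h (Real.log n / Real.log q)) atTop (nhds (∫ u in (0 : ℝ)..1, h u)) := by
  have hlog : Tendsto (fun q : ℕ => Real.log q) atTop atTop :=
    Real.tendsto_log_atTop.comp tendsto_natCast_atTop_atTop
  refine tendsto_sum_of_tendsto_cdf (fun q : ℕ => Finset.Icc 1 q)
    (fun q n => Λ n / n / Real.log q) (fun q n => Real.log n / Real.log q) ?_ ?_ ?_ hh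
  · intro q n
    exact div_nonneg (div_nonneg vonMangoldt_nonneg (by positivity)) (Real.log_natCast_nonneg q)
  · intro q n hn hne
    rw [Finset.mem_Icc] at hn
    have hL : Real.log q ≠ 0 := by rintro h; simp [h] at hne
    have hL0 : 0 < Real.log q := lt_of_le_of_ne (Real.log_natCast_nonneg q) hL.symm
    have hΛ : Λ n ≠ 0 := by rintro h; simp [h] at hne
    have hn1 : 1 < n := (vonMangoldt_ne_zero_iff.1 hΛ).one_lt
    refine ⟨div_pos (Real.log_pos (by exact_mod_cast hn1)) hL0, (div_le_one hL0).2 ?_⟩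
    exact Real.log_le_log (by exact_mod_cast hn.1) (by exact_mod_cast hn.2)
  · intro t ht0 ht1
    have hz : Tendsto (fun q : ℕ => (Real.log 4 + 4 + Real.log 2) / Real.log q) atTop (nhds 0) :=
      hlog.const_div_atTop _
    refine tendsto_iff_norm_sub_tendsto_zero.2 (squeeze_zero' (Eventually.of_forall fun _ =>
      norm_nonneg _) ?_ hz)
    filter_upwards [hlog.eventually_gt_atTop 0, eventually_ge_atTop 1] with q hL hq
    have hq0 : (0 : ℝ) < q := by exact_mod_cast hq
    set y := Real.exp (t * Real.log q) with hy
    have hy1 : 1 ≤ y := Real.one_le_exp (by positivity)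
    have hyq : y ≤ q := by
      rw [hy, ← Real.le_log_iff_exp_le hq0]; nlinarith
    have hM : 1 ≤ ⌊y⌋₊ := Nat.le_floor (by simpa using hy1)
    have e1 : ∑ n ∈ Finset.Icc 1 q, (if Real.log n / Real.log q ≤ t then Λ n / n / Real.log q
        else 0) = (∑ n ∈ Finset.Icc 1 ⌊y⌋₊, Λ n / n) / Real.log q := by
      rw [← Finset.sum_filter, Finset.sum_div]
      refine Finset.sum_congr ?_ fun _ _ => rfl
      ext n
      simp only [Finset.mem_filter, Finset.mem_Icc]
      constructor
      · rintro ⟨⟨h1, h2⟩, h3⟩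
        rw [div_le_iff₀ hL, Real.log_le_iff_le_exp (by exact_mod_cast h1)] at h3
        exact ⟨h1, Nat.le_floor h3⟩
      · rintro ⟨h1, h2⟩
        have h3 : (n : ℝ) ≤ y := (Nat.le_floor_iff (by linarith)).1 h2
        refine ⟨⟨h1, by exact_mod_cast h3.trans hyq⟩, ?_⟩
        rwa [div_le_iff₀ hL, Real.log_le_iff_le_exp (by exact_mod_cast h1)]
    rw [e1, Real.norm_eq_abs]
    have e2 : (∑ n ∈ Finset.Icc 1 ⌊y⌋₊, Λ n / n) / Real.log q - t =
        (∑ n ∈ Finset.Icc 1 ⌊y⌋₊, Λ n / n - Real.log y) / Real.log q := by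
      rw [hy, Real.log_exp]; field_simp
    rw [e2, abs_div, abs_of_pos hL]
    gcongr
    have m1 := abs_sum_vonMangoldt_div_sub_log_le hM
    have m2 : |Real.log ⌊y⌋₊ - Real.log y| ≤ Real.log 2 := by
      have hf0 : (0 : ℝ) < ⌊y⌋₊ := by exact_mod_cast hM
      have hf1 : (⌊y⌋₊ : ℝ) ≤ y := Nat.floor_le (by linarith)
      have hf2 : y ≤ 2 * ⌊y⌋₊ := by
        have := Nat.lt_floor_add_one y
        have : (1 : ℝ) ≤ ⌊y⌋₊ := by exact_mod_cast hM
        linarith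
      have l1 := Real.log_le_log hf0 hf1
      have l2 := Real.log_le_log (by linarith) hf2
      rw [Real.log_mul (by norm_num) hf0.ne'] at l2
      rw [abs_le]; constructor <;> linarith [Real.log_pos (by norm_num : (1 : ℝ) < 2)]
    exact (abs_sub_le _ _ _).trans (add_le_add m1 m2)

/-- The restriction of `f` to the integers whose least prime factor lies in `P`. -/
noncomputable def restrictMinFac (f : ArithmeticFunction ℝ) (P : Finset ℕ) :
    ArithmeticFunction ℝ :=
  ⟨fun n => if n.minFac ∈ P then f n else 0, by simp⟩

theorem restrictMinFac_apply (f : ArithmeticFunction ℝ) (P : Finset ℕ) (n : ℕ) :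
    restrictMinFac f P n = if n.minFac ∈ P then f n else 0 := rfl

theorem SuppLe.restrictMinFac {f : ArithmeticFunction ℝ} {X : ℝ} (hf : SuppLe f X)
    (P : Finset ℕ) : SuppLe (restrictMinFac f P) X := fun n hn => by
  simp [restrictMinFac_apply, hf n hn]

theorem restrictMinFac_insert (f : ArithmeticFunction ℝ) {P : Finset ℕ} {p : ℕ} (hp : p ∉ P) :
    restrictMinFac f (insert p P) = restrictMinFac f {p} + restrictMinFac f P := by
  ext n
  simp only [restrictMinFac_apply, ArithmeticFunction.add_apply, Finset.mem_insert,
    Finset.mem_singleton]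
  by_cases h : n.minFac = p
  · simp [h, hp]
  · simp [h]

theorem abs_pow_apply_le {v : ArithmeticFunction ℝ} {c : ℝ} (hc : 0 ≤ c)
    (hv : ∀ n, |v n| ≤ c * (Λ n / √n)) (k n : ℕ) :
    |(v ^ k) n| ≤ c ^ k * (Real.log n ^ k / √n) := by
  induction k generalizing n with
  | zero =>
    rcases eq_or_ne n 1 with rfl | hn
    · simp
    · simp [hn]
  | succ k ih =>
    rw [pow_succ', ArithmeticFunction.mul_apply]
    calc _ ≤ ∑ x ∈ n.divisorsAntidiagonal,
          Λ x.1 * (c ^ (k + 1) * (Real.log n ^ k / √n)) := by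
          refine (Finset.abs_sum_le_sum_abs _ _).trans (Finset.sum_le_sum fun x hx => ?_)
          rw [Nat.mem_divisorsAntidiagonal] at hx
          have hx2 : 0 < x.2 := Nat.pos_of_ne_zero (by rintro h; simp [h] at hx; omega)
          have hx1 : 0 < x.1 := Nat.pos_of_ne_zero (by rintro h; simp [h] at hx; omega)
          have hle : Real.log x.2 ≤ Real.log n := by
            refine Real.log_le_log (by exact_mod_cast hx2) ?_
            exact_mod_cast Nat.le_of_dvd (by omega) (hx.1 ▸ dvd_mul_left _ _)
          have h0 : 0 ≤ Real.log x.2 := Real.log_natCast_nonneg _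
          have hsq : √(n : ℝ) = √x.1 * √x.2 := by
            rw [← hx.1, Nat.cast_mul, Real.sqrt_mul (by positivity)]
          have hΛ : 0 ≤ Λ x.1 := vonMangoldt_nonneg
          rw [abs_mul]
          calc _ ≤ (c * (Λ x.1 / √x.1)) * (c ^ k * (Real.log x.2 ^ k / √x.2)) := by
                gcongr
                · exact hv _
                · exact ih _
            _ ≤ (c * (Λ x.1 / √x.1)) * (c ^ k * (Real.log n ^ k / √x.2)) := by gcongr
            _ = _ := by rw [hsq]; field_simp; ring
      _ = Real.log n * (c ^ (k + 1) * (Real.log n ^ k / √n)) := by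
          rw [← Finset.sum_mul, ← vonMangoldt_sum]
          congr 1
          exact Nat.sum_divisorsAntidiagonal (fun a _ => Λ a)
      _ = _ := by ring

theorem sq_log_div_le (x : ℝ) (hx : 1 ≤ x) : Real.log x ^ 2 / x ≤ 4 := by
  rw [div_le_iff₀ (by linarith)]
  have h1 : Real.log x ≤ 2 * √x := by
    have := Real.log_le_sub_one_of_pos (Real.sqrt_pos.2 (by linarith : 0 < x))
    rw [Real.log_sqrt (by linarith)] at this
    linarith
  have h2 := Real.log_nonneg hx
  calc Real.log x ^ 2 ≤ (2 * √x) ^ 2 := by gcongr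
    _ = 4 * x := by rw [mul_pow, Real.sq_sqrt (by linarith)]; ring

/-- A constant dominating sums over higher powers of a prime. -/
noncomputable def primePowConst : ℝ := ∑' j : ℕ, ((j : ℝ) + 2) ^ 2 / 2 ^ j

theorem summable_primePowConst : Summable fun j : ℕ => ((j : ℝ) + 2) ^ 2 / 2 ^ j := by
  have h := fun k => summable_pow_mul_geometric_of_norm_lt_one (R := ℝ) k (r := 1 / 2)
    (by norm_num)
  refine (((h 2).add ((h 1).mul_left 4)).add ((h 0).mul_left 4)).congr fun j => ?_
  rw [div_pow, one_pow]; ring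

theorem primePowConst_nonneg : 0 ≤ primePowConst := tsum_nonneg fun j => by positivity

theorem abs_tsum_le_of_higher_prime_powers {p : ℕ} (hp : p.Prime) {G : ℕ → ℝ} {B : ℝ} (hB : 0 ≤ B)
    (h0 : G 0 = 0) (h1 : G 1 = 0)
    (h : ∀ a ≥ 2, |G a| ≤ B * ((a * Real.log p) ^ 2 / (p : ℝ) ^ a)) :
    |∑' a, G a| ≤ B * primePowConst * (Real.log p ^ 2 / (p : ℝ) ^ 2) := by
  have hp2 : (2 : ℝ) ≤ p := by exact_mod_cast hp.two_le
  have hb : ∀ j, ‖G (j + 2)‖ ≤ B * (Real.log p ^ 2 / (p : ℝ) ^ 2) * (((j : ℝ) + 2) ^ 2 / 2 ^ j) := by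
    intro j
    refine (h (j + 2) (by omega)).trans ?_
    have : (2 : ℝ) ^ j ≤ (p : ℝ) ^ j := by gcongr
    calc _ = B * (Real.log p ^ 2 / (p : ℝ) ^ 2) * (((j : ℝ) + 2) ^ 2 / (p : ℝ) ^ j) := by
          push_cast; rw [pow_add]; field_simp
      _ ≤ _ := by gcongr
  have hs := summable_primePowConst.mul_left (B * (Real.log p ^ 2 / (p : ℝ) ^ 2))
  have hG : Summable G := (summable_nat_add_iff 2).1 (Summable.of_norm_bounded hs hb)
  have e : ∑' a, G a = ∑' j, G (j + 2) := by
    rw [← hG.sum_add_tsum_nat_add 2]; simp [Finset.sum_range_succ, h0, h1]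
  rw [e]
  refine (tsum_of_norm_bounded hs.hasSum hb).trans_eq ?_
  rw [tsum_mul_left, primePowConst]; ring

theorem tsum_comp_prime_pow {p : ℕ} (hp : p.Prime) {F : ℕ → ℝ} (hF : ∀ n, (∀ c, n ≠ p ^ c) → F n = 0) :
    ∑' n, F n = ∑' a, F (p ^ a) := by
  symm
  refine Function.Injective.tsum_eq (Nat.pow_right_injective hp.two_le) fun n hn => ?_
  by_contra h
  exact hn (hF n fun c hc => h ⟨c, hc.symm⟩)

theorem IsPrimePow.eq_minFac_pow {n : ℕ} (h : IsPrimePow n) : ∃ c, n = n.minFac ^ c ∧ c ≠ 0 ∧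
    n.minFac.Prime := by
  obtain ⟨p, k, hp, hk, rfl⟩ := (isPrimePow_nat_iff _).1 h
  rw [hp.pow_minFac hk.ne']
  exact ⟨k, rfl, hk.ne', hp⟩

theorem tsum_eq_sum_tsum_prime_pow {F : ℕ → ℝ} (hF : ∀ n, F n ≠ 0 → IsPrimePow n) {N : ℕ}
    (hN : ∀ n, N < n → F n = 0) :
    ∑' n, F n = ∑ p ∈ (Finset.range (N + 1)).filter Nat.Prime, ∑' a, F (p ^ a) := by
  have h1 : ∀ p ∈ (Finset.range (N + 1)).filter Nat.Prime,
      ∑' a, F (p ^ a) = ∑' n, if n.minFac = p then F n else 0 := by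
    intro p hp
    have hpp : p.Prime := (Finset.mem_filter.1 hp).2
    rw [tsum_comp_prime_pow hpp (F := fun n => if n.minFac = p then F n else 0)]
    · refine tsum_congr fun a => ?_
      rcases Nat.eq_zero_or_pos a with rfl | ha
      · have : F 1 = 0 := by by_contra h; exact not_isPrimePow_one (hF 1 h)
        simp [this]
      · rw [if_pos (hpp.pow_minFac ha.ne')]
    · intro n hn
      split_ifs with h
      · by_contra h'
        obtain ⟨c, hc, _⟩ := (hF n h').eq_minFac_pow
        exact hn c (h ▸ hc)
      · rfl
  rw [Finset.sum_congr rfl h1, ← Summable.tsum_finsetSum]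
  · refine tsum_congr fun n => ?_
    by_cases hn : F n = 0
    · simp [hn]
    · obtain ⟨c, hc, hc0, hp⟩ := (hF n hn).eq_minFac_pow
      have hnN : n ≤ N := by by_contra! h; exact hn (hN n h)
      rw [Finset.sum_ite_eq, if_pos]
      rw [Finset.mem_filter, Finset.mem_range]
      have := Nat.minFac_le (hF n hn).pos
      exact ⟨by omega, hp⟩
  · intro p _
    refine summable_of_ne_finset_zero (s := Finset.range (N + 1)) fun n hn => ?_
    have : N < n := by rw [Finset.mem_range] at hn; omega
    simp [hN n this]

/-- A constant dominating sums of `(log n / n) ^ 2`. -/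
noncomputable def logSqConst : ℝ := ∑' n : ℕ, Real.log n ^ 2 / (n : ℝ) ^ 2

theorem summable_logSqConst : Summable fun n : ℕ => Real.log n ^ 2 / (n : ℝ) ^ 2 := by
  have h := (Real.summable_one_div_nat_rpow (p := 3 / 2)).2 (by norm_num)
  refine Summable.of_nonneg_of_le (fun n => by positivity) (fun n => ?_) (h.mul_left 16)
  rcases Nat.eq_zero_or_pos n with rfl | hn
  · simp
  have hn0 : (0 : ℝ) < n := by exact_mod_cast hn
  have hl : Real.log n ≤ 4 * (n : ℝ) ^ (1 / 4 : ℝ) := by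
    have := Real.log_le_rpow_div hn0.le (ε := 1 / 4) (by norm_num)
    linarith
  have h0 := Real.log_natCast_nonneg n
  have e : (n : ℝ) ^ 2 = (n : ℝ) ^ (1 / 2 : ℝ) * (n : ℝ) ^ (3 / 2 : ℝ) := by
    rw [← Real.rpow_add hn0]; norm_num
  have e2 : ((n : ℝ) ^ (1 / 4 : ℝ)) ^ 2 = (n : ℝ) ^ (1 / 2 : ℝ) := by
    rw [← Real.rpow_natCast, ← Real.rpow_mul hn0.le]; norm_num
  calc Real.log n ^ 2 / (n : ℝ) ^ 2 ≤ (4 * (n : ℝ) ^ (1 / 4 : ℝ)) ^ 2 / (n : ℝ) ^ 2 := by gcongr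
    _ = 16 * (1 / (n : ℝ) ^ (3 / 2 : ℝ)) := by
      rw [mul_pow, e2, e]; field_simp; norm_num

theorem logSqConst_nonneg : 0 ≤ logSqConst := tsum_nonneg fun j => by positivity

theorem sum_log_sq_div_le (s : Finset ℕ) : ∑ p ∈ s, Real.log p ^ 2 / (p : ℝ) ^ 2 ≤ logSqConst :=
  summable_logSqConst.sum_le_tsum s fun n _ => by positivity

section Moments

variable {v : ArithmeticFunction ℝ} {c X : ℝ}

theorem isPrimePow_of_ne_zero (hv : ∀ n, |v n| ≤ c * (Λ n / √n)) {n : ℕ} (hn : v n ≠ 0) :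
    IsPrimePow n := by
  by_contra h
  have := hv n
  rw [vonMangoldt_eq_zero_iff.2 h] at this
  simp at this
  exact hn this

theorem restrictMinFac_singleton_eq_zero (hv : ∀ n, |v n| ≤ c * (Λ n / √n)) (p n : ℕ)
    (hn : ∀ a, n ≠ p ^ a) : restrictMinFac v {p} n = 0 := by
  rw [restrictMinFac_apply]
  split_ifs with h
  · by_contra h'
    obtain ⟨a, ha, _⟩ := (isPrimePow_of_ne_zero hv h').eq_minFac_pow
    rw [Finset.mem_singleton] at h
    exact hn a (h ▸ ha)
  · rfl

theorem restrictMinFac_eq_zero_of_dvd (hv : ∀ n, |v n| ≤ c * (Λ n / √n)) {P : Finset ℕ} {p : ℕ}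
    (hp : p.Prime) (hpP : p ∉ P) (n : ℕ) (hn : p ∣ n) : restrictMinFac v P n = 0 := by
  rw [restrictMinFac_apply]
  split_ifs with h
  · by_contra h'
    obtain ⟨a, ha, _, hr⟩ := (isPrimePow_of_ne_zero hv h').eq_minFac_pow
    rw [ha] at hn
    have := (Nat.prime_dvd_prime_iff_eq hp hr).1 (hp.dvd_of_dvd_pow hn)
    exact hpP (this ▸ h)
  · rfl

theorem abs_restrictMinFac_le (hc : 0 ≤ c) (hv : ∀ n, |v n| ≤ c * (Λ n / √n)) (P : Finset ℕ)
    (n : ℕ) : |restrictMinFac v P n| ≤ c * (Λ n / √n) := by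
  rw [restrictMinFac_apply]
  split_ifs
  · exact hv n
  · have : 0 ≤ Λ n := vonMangoldt_nonneg
    simp; positivity

theorem apply_one_eq_zero (hv : ∀ n, |v n| ≤ c * (Λ n / √n)) : v 1 = 0 := by
  by_contra h
  exact not_isPrimePow_one (isPrimePow_of_ne_zero hv h)

theorem pow_succ_apply_one {u : ArithmeticFunction ℝ} (hu : u 1 = 0) (i : ℕ) : (u ^ (i + 1)) 1 = 0 := by
  rw [pow_succ, ArithmeticFunction.mul_apply_one, hu, mul_zero]

theorem pow_apply_prime {u : ArithmeticFunction ℝ} (hu : u 1 = 0) {p : ℕ} (hp : p.Prime) (i : ℕ) :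
    (u ^ (i + 2)) p = 0 := by
  rw [pow_succ, ArithmeticFunction.mul_apply]
  refine Finset.sum_eq_zero fun x hx => ?_
  rw [Nat.mem_divisorsAntidiagonal] at hx
  rcases (Nat.dvd_prime hp).1 (hx.1 ▸ dvd_mul_right x.1 x.2) with h | h
  · rw [h, pow_succ_apply_one hu, zero_mul]
  · have : x.2 = 1 := by
      have h1 := hx.1
      rw [h] at h1
      exact Nat.eq_of_mul_eq_mul_left hp.pos (by omega)
    rw [this, hu, mul_zero]

theorem pairing_one_right (f : ArithmeticFunction ℝ) : pairing f 1 = f 1 := by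
  rw [pairing, tsum_eq_single 1]
  · simp
  · intro n hn; simp [hn]

theorem pairing_one_left (f : ArithmeticFunction ℝ) : pairing 1 f = f 1 := by
  rw [pairing, tsum_eq_single 1]
  · simp
  · intro n hn; simp [hn]

theorem abs_pow_apply_le_log (hc : 0 ≤ c) (hX : 1 ≤ X) (hv : ∀ n, |v n| ≤ c * (Λ n / √n))
    (hvX : SuppLe v X) {n : ℕ} {D : ℝ} (hD : 1 ≤ D) (hcD : c * (n * Real.log X) ≤ D) {i : ℕ}
    (hi : 1 ≤ i) (hin : i ≤ n) (A : ℕ) : |(v ^ i) A| ≤ c * D ^ n * (Real.log A / √A) := by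
  have hA0 := Real.log_natCast_nonneg A
  by_cases hA : X ^ i < A
  · rw [hvX.pow (by linarith) i A hA, abs_zero]
    positivity
  rcases Nat.eq_zero_or_pos A with rfl | hApos
  · simp
  have h1 : c * Real.log A ≤ D := by
    have : Real.log A ≤ i * Real.log X := by
      rw [← Real.log_pow]
      exact Real.log_le_log (by exact_mod_cast hApos) (not_lt.1 hA)
    have hX0 := Real.log_nonneg hX
    calc _ ≤ c * (n * Real.log X) := by
          gcongr
          exact this.trans (by gcongr)
      _ ≤ D := hcD
  refine (abs_pow_apply_le hc hv i A).trans ?_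
  obtain ⟨j, rfl⟩ := Nat.exists_eq_add_of_le' hi
  have h2 : (c * Real.log A) ^ j ≤ D ^ n :=
    (pow_le_pow_left₀ (by positivity) h1 j).trans (pow_le_pow_right₀ hD (by omega))
  calc c ^ (j + 1) * (Real.log A ^ (j + 1) / √A)
      = c * (c * Real.log A) ^ j * (Real.log A / √A) := by ring
    _ ≤ _ := by gcongr

theorem abs_pairing_pow_le (hc : 0 ≤ c) (hX : 1 ≤ X) (hv : ∀ n, |v n| ≤ c * (Λ n / √n))
    (hvX : SuppLe v X) {n : ℕ} {D : ℝ} (hD : 1 ≤ D) (hcD : c * (n * Real.log X) ≤ D) {p : ℕ}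
    (hp : p.Prime) (hvp : ∀ n, (∀ a, n ≠ p ^ a) → v n = 0) {i j : ℕ}
    (hi : 1 ≤ i) (hj : 1 ≤ j) (hij : 3 ≤ i + j) (hin : i ≤ n) (hjn : j ≤ n) :
    |pairing (v ^ i) (v ^ j)| ≤
      (D ^ n * D ^ n * primePowConst) * (c ^ 2 * (Real.log p ^ 2 / (p : ℝ) ^ 2)) := by
  have h1 := apply_one_eq_zero hv
  obtain ⟨i, rfl⟩ := Nat.exists_eq_add_of_le' hi
  obtain ⟨j, rfl⟩ := Nat.exists_eq_add_of_le' hj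
  rw [pairing, tsum_comp_prime_pow hp (fun m hm => by
    rw [pow_eq_zero_of_ne_prime_pow hvp _ m hm, zero_mul])]
  refine (abs_tsum_le_of_higher_prime_powers hp (B := c ^ 2 * (D ^ n * D ^ n)) (by positivity)
    ?_ ?_ ?_).trans_eq (by ring)
  · rw [pow_zero, pow_succ_apply_one h1, zero_mul]
  · rw [pow_one]
    rcases i with _ | i
    · rcases j with _ | j
      · omega
      · rw [pow_apply_prime h1 hp j, mul_zero]
    · rw [pow_apply_prime h1 hp i, zero_mul]
  · intro a _
    rw [abs_mul]
    have b1 := abs_pow_apply_le_log hc hX hv hvX hD hcD hi hin (p ^ a)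
    have b2 := abs_pow_apply_le_log hc hX hv hvX hD hcD hj hjn (p ^ a)
    refine (mul_le_mul b1 b2 (abs_nonneg _) (le_trans (abs_nonneg _) b1)).trans_eq ?_
    have hs : √((p ^ a : ℕ) : ℝ) * √((p ^ a : ℕ) : ℝ) = (p : ℝ) ^ a := by
      rw [Real.mul_self_sqrt (by positivity)]; push_cast; rfl
    rw [← hs]
    have hsp : 0 < √((p ^ a : ℕ) : ℝ) := Real.sqrt_pos.2 (by
      have := hp.pos
      positivity)
    have hl : Real.log ((p ^ a : ℕ) : ℝ) = a * Real.log p := by push_cast; rw [Real.log_pow]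
    rw [hl]
    field_simp

theorem tsum_sq_prime_pow_le (hv : ∀ n, |v n| ≤ c * (Λ n / √n))
    (hvX : SuppLe v X) {p : ℕ} (hp : p.Prime) :
    ∑' a, v (p ^ a) ^ 2 ≤ c ^ 2 * (4 * (1 + primePowConst)) := by
  have hp1 : (1 : ℝ) ≤ p := by exact_mod_cast hp.one_lt.le
  obtain ⟨N, hN⟩ := exists_nat_ge X
  have hsq : ∀ a : ℕ, a ≠ 0 → v (p ^ a) ^ 2 ≤ c ^ 2 * (Real.log p ^ 2 / (p : ℝ) ^ a) := by
    intro a ha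
    have := hv (p ^ a)
    rw [vonMangoldt_apply_pow ha, vonMangoldt_apply_prime hp] at this
    have h2 := pow_le_pow_left₀ (abs_nonneg _) this 2
    rw [sq_abs] at h2
    refine h2.trans_eq ?_
    rw [mul_pow, div_pow, Real.sq_sqrt (by positivity)]
    push_cast; rfl
  have hsum : Summable fun a => v (p ^ a) ^ 2 := by
    refine summable_of_ne_finset_zero (s := Finset.range (N + 1)) fun a ha => ?_
    rw [hvX (p ^ a), zero_pow two_ne_zero]
    rw [Finset.mem_range, not_lt] at ha
    refine hN.trans_lt ?_
    have := Nat.lt_pow_self hp.one_lt (n := a)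
    exact_mod_cast (by omega : N < p ^ a)
  rw [hsum.tsum_eq_add_tsum_ite 1, pow_one]
  have t1 : v p ^ 2 ≤ c ^ 2 * 4 := by
    have := hsq 1 one_ne_zero
    rw [pow_one, pow_one] at this
    exact this.trans (by gcongr; exact sq_log_div_le _ hp1)
  have t2 := abs_tsum_le_of_higher_prime_powers hp (G := fun a => if a = 1 then 0 else v (p ^ a) ^ 2)
    (B := c ^ 2) (by positivity) (by simp [apply_one_eq_zero hv]) (by simp) (by
      intro a ha
      rw [if_neg (by omega), abs_of_nonneg (by positivity)]
      refine (hsq a (by omega)).trans ?_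
      have : (1 : ℝ) ≤ a := by exact_mod_cast (by omega : 1 ≤ a)
      have h0 := Real.log_nonneg hp1
      gcongr
      nlinarith)
  have t3 : Real.log p ^ 2 / (p : ℝ) ^ 2 ≤ 4 := by
    refine le_trans ?_ (sq_log_div_le _ hp1)
    gcongr
    nlinarith
  have t4 := (le_abs_self _).trans t2
  have t5 : c ^ 2 * primePowConst * (Real.log p ^ 2 / (p : ℝ) ^ 2) ≤ c ^ 2 * primePowConst * 4 := by
    have := primePowConst_nonneg
    gcongr
  linarith

theorem exists_abs_pairing_sub_gaussMoment_le (n : ℕ) {B D : ℝ} (hB : 1 ≤ B) (hD : 1 ≤ D) :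
    ∃ K : ℝ, 0 ≤ K ∧ ∃ K₀ : ℝ, 0 ≤ K₀ ∧ ∀ (v : ArithmeticFunction ℝ) (c X : ℝ), 0 ≤ c → 1 ≤ X →
      (∀ n, |v n| ≤ c * (Λ n / √n)) → SuppLe v X → c * (n * Real.log X) ≤ D →
      ∑' a, v a ^ 2 ≤ B → K₀ * c ^ 2 ≤ 1 → ∀ k ≤ n, ∀ l ≤ n,
      |pairing (v ^ k) (v ^ l) - gaussMoment (∑' a, v a ^ 2) k l| ≤ K * c ^ 2 := by
  have hpc := primePowConst_nonneg
  obtain ⟨K, hK0, hK⟩ := MomentFamily.exists_bound hB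
    (by positivity : 0 ≤ D ^ n * D ^ n * primePowConst) n n le_rfl
  have hlc := logSqConst_nonneg
  refine ⟨K * (4 * (1 + primePowConst) * B + logSqConst), by positivity,
    4 * (1 + primePowConst) * B + logSqConst, by positivity, ?_⟩
  intro v c X hc hX hv hvX hcD hvB hc1 k hk l hl
  obtain ⟨N, hN⟩ := exists_nat_ge X
  set P₀ := (Finset.range (N + 1)).filter Nat.Prime with hP₀
  have hvN : ∀ a, N < a → v a = 0 := fun a ha => hvX a (hN.trans_lt (by exact_mod_cast ha))
  have hprime : ∀ p ∈ P₀, p.Prime := fun p hp => (Finset.mem_filter.1 hp).2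
  have hS : ∑' a, v a ^ 2 = ∑ p ∈ P₀, ∑' a, v (p ^ a) ^ 2 :=
    tsum_eq_sum_tsum_prime_pow (F := fun a => v a ^ 2)
      (fun a ha => isPrimePow_of_ne_zero hv (by rintro h; simp [h] at ha))
      (fun a ha => by simp [hvN a ha])
  have hfull : restrictMinFac v P₀ = v := by
    ext a
    rw [restrictMinFac_apply]
    split_ifs with h
    · rfl
    · by_contra h'
      have hpp := isPrimePow_of_ne_zero hv (Ne.symm h')
      obtain ⟨_, _, _, hr⟩ := hpp.eq_minFac_pow
      have hle := Nat.minFac_le hpp.pos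
      have : a ≤ N := by by_contra! h2; exact h' (hvN a h2).symm
      exact h (Finset.mem_filter.2 ⟨Finset.mem_range.2 (by omega), hr⟩)
  have fam : MomentFamily P₀ n (D ^ n * D ^ n * primePowConst) (fun p => ∑' a, v (p ^ a) ^ 2)
      (fun p => c ^ 2 * (Real.log p ^ 2 / (p : ℝ) ^ 2))
      (fun p i j => pairing (restrictMinFac v {p} ^ i) (restrictMinFac v {p} ^ j))
      (fun P k l => pairing (restrictMinFac v P ^ k) (restrictMinFac v P ^ l)) := by
    have h1 := fun P => apply_one_eq_zero (abs_restrictMinFac_le hc hv P)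
    constructor
    · intro k l
      have : restrictMinFac v ∅ = 0 := by ext; simp [restrictMinFac_apply]
      rcases k with _ | k
      · rcases l with _ | l
        · simp [pairing_one_left]
        · simp [pairing_one_left, this]
      · simp [this, pairing]
    · intro P p hpP hP k l
      have hp := hprime p (hP (Finset.mem_insert_self p P))
      rw [restrictMinFac_insert v hpP]
      exact pairing_add_pow hp (restrictMinFac_eq_zero_of_dvd hv hp hpP)
        (restrictMinFac_singleton_eq_zero hv p) hX (hvX.restrictMinFac _) (hvX.restrictMinFac _) k l
    · intro p _
      simp [pairing_one_left]
    · intro p _ i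
      rw [pow_zero, pairing_one_right, pow_succ_apply_one (h1 _)]
    · intro p _ i
      rw [pow_zero, pairing_one_left, pow_succ_apply_one (h1 _)]
    · intro p hp
      have hpp := hprime p hp
      rw [pow_one, pairing, tsum_comp_prime_pow hpp (fun m hm => by
        rw [restrictMinFac_singleton_eq_zero hv p m hm, zero_mul])]
      refine tsum_congr fun a => ?_
      rcases Nat.eq_zero_or_pos a with rfl | ha
      · simp [h1, apply_one_eq_zero hv]
      · rw [restrictMinFac_apply, if_pos (by rw [hpp.pow_minFac ha.ne']; simp), sq]
    · intro p _
      exact tsum_nonneg fun a => sq_nonneg _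
    · intro p _
      positivity
    · intro p hp i j hi hj hij hin hjn
      exact abs_pairing_pow_le hc hX (abs_restrictMinFac_le hc hv _) (hvX.restrictMinFac _) hD hcD
        (hprime p hp) (restrictMinFac_singleton_eq_zero hv p) hi hj hij hin hjn
  have := hK k hk P₀ _ _ _ _ ((4 * (1 + primePowConst) * B + logSqConst) * c ^ 2) fam
    (hS ▸ hvB) ?_ hc1 P₀ le_rfl l hl
  · rw [hfull, ← hS] at this
    exact this.trans_eq (by ring)
  · rw [Finset.sum_add_distrib, ← Finset.mul_sum]
    have t1 : ∑ p ∈ P₀, (∑' a, v (p ^ a) ^ 2) ^ 2 ≤ c ^ 2 * (4 * (1 + primePowConst)) * B := by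
      calc _ ≤ ∑ p ∈ P₀, c ^ 2 * (4 * (1 + primePowConst)) * ∑' a, v (p ^ a) ^ 2 := by
            refine Finset.sum_le_sum fun p hp => ?_
            rw [sq]
            exact mul_le_mul_of_nonneg_right (tsum_sq_prime_pow_le hv hvX (hprime p hp))
              (tsum_nonneg fun a => sq_nonneg _)
        _ = c ^ 2 * (4 * (1 + primePowConst)) * ∑' a, v a ^ 2 := by rw [← Finset.mul_sum, hS]
        _ ≤ _ := by gcongr
    have t2 := mul_le_mul_of_nonneg_left (sum_log_sq_div_le P₀) (sq_nonneg c)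
    linarith

end Moments

/-- The coefficients of the Dirichlet polynomial underlying `Wosc`, restricted to integers not
divisible by `q`. -/
noncomputable def primeWeight (q : ℕ) (fhat : ℝ → ℝ) : ArithmeticFunction ℝ :=
  ⟨fun n => if q ∣ n then 0 else Λ n / √n * fhat (Real.log n / Real.log q) / Real.log q, by simp⟩

theorem primeWeight_apply (q : ℕ) (fhat : ℝ → ℝ) (n : ℕ) : primeWeight q fhat n =
    if q ∣ n then 0 else Λ n / √n * fhat (Real.log n / Real.log q) / Real.log q := rfl

section Weight

variable {q : ℕ} {fhat : ℝ → ℝ} {C α : ℝ}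

theorem abs_primeWeight_le (hC : ∀ u, |fhat u| ≤ C) (n : ℕ) :
    |primeWeight q fhat n| ≤ C / Real.log q * (Λ n / √n) := by
  have hC0 : 0 ≤ C := (abs_nonneg _).trans (hC 0)
  have hL : 0 ≤ Real.log q := Real.log_natCast_nonneg q
  have hΛ : 0 ≤ Λ n := vonMangoldt_nonneg
  rw [primeWeight_apply]
  split_ifs with h
  · simp only [abs_zero]; positivity
  · rw [abs_div, abs_mul, abs_of_nonneg hL, abs_of_nonneg (by positivity : 0 ≤ Λ n / √n)]
    calc _ ≤ Λ n / √n * C / Real.log q := by gcongr; exact hC _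
      _ = _ := by ring

theorem suppLe_primeWeight (hq : 1 < q) (hfhat : ∀ u, α < u → fhat u = 0) :
    SuppLe (primeWeight q fhat) ((q : ℝ) ^ α) := by
  intro n hn
  have hq0 : (0 : ℝ) < q := by exact_mod_cast (by omega : 0 < q)
  have hL : 0 < Real.log q := Real.log_pos (by exact_mod_cast hq)
  have h : α < Real.log n / Real.log q := by
    rw [lt_div_iff₀ hL, ← Real.log_rpow hq0]
    exact Real.log_lt_log (by positivity) hn
  simp [primeWeight_apply, hfhat _ h]

theorem primeWeight_eq_zero_of_dvd (n : ℕ) (hn : q ∣ n) : primeWeight q fhat n = 0 := by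
  simp [primeWeight_apply, hn]

theorem primeWeight_apply_of_lt_one (hq : q.Prime) (hfhat : ∀ u, α < u → fhat u = 0) (hα : α < 1)
    (n : ℕ) : primeWeight q fhat n =
      Λ n / √n * fhat (Real.log n / Real.log q) / Real.log q := by
  rw [primeWeight_apply]
  split_ifs with h
  · by_cases hΛ : Λ n = 0
    · simp [hΛ]
    have hn0 : n ≠ 0 := by rintro rfl; simp at hΛ
    have hL : 0 < Real.log q := Real.log_pos (by exact_mod_cast hq.one_lt)
    have h1 : 1 ≤ Real.log n / Real.log q := by
      rw [le_div_iff₀ hL, one_mul]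
      refine Real.log_le_log (by exact_mod_cast hq.pos) ?_
      exact_mod_cast Nat.le_of_dvd (Nat.pos_of_ne_zero hn0) h
    simp [hfhat _ (hα.trans_le h1)]
  · rfl

theorem abs_tsum_primeWeight_sq_sub_le (hq : q.Prime) (hC : ∀ u, |fhat u| ≤ C)
    (hfhat : ∀ u, α < u → fhat u = 0) (hα : α < 1) :
    |∑' n, primeWeight q fhat n ^ 2 - ∑ n ∈ Finset.Icc 1 q, Λ n / n / Real.log q *
      (Real.log n / Real.log q * fhat (Real.log n / Real.log q) ^ 2)| ≤
      (C / Real.log q) ^ 2 * primePowConst * logSqConst := by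
  have hL : 0 < Real.log q := Real.log_pos (by exact_mod_cast hq.one_lt)
  have hC0 : 0 ≤ C := (abs_nonneg _).trans (hC 0)
  have hbig : ∀ n : ℕ, q < n → fhat (Real.log n / Real.log q) = 0 := by
    intro n hn
    refine hfhat _ (hα.trans ?_)
    rw [lt_div_iff₀ hL, one_mul]
    exact Real.log_lt_log (by exact_mod_cast hq.pos) (by exact_mod_cast hn)
  set H : ℕ → ℝ := fun n => Λ n / n / Real.log q *
      (Real.log n / Real.log q * fhat (Real.log n / Real.log q) ^ 2) with hH
  set F : ℕ → ℝ := fun n => primeWeight q fhat n ^ 2 - H n with hF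
  have hFeq : ∀ n : ℕ, F n = Λ n * (Λ n - Real.log n) / n *
      (fhat (Real.log n / Real.log q) / Real.log q) ^ 2 := by
    intro n
    simp only [hF, hH, primeWeight_apply_of_lt_one hq hfhat hα]
    rw [div_pow, mul_pow, div_pow, Real.sq_sqrt (by positivity)]
    field_simp
  have hwfin : ∀ n : ℕ, q < n → primeWeight q fhat n = 0 := fun n hn => by
    rw [primeWeight_apply_of_lt_one hq hfhat hα, hbig n hn]; simp
  have hnot : ∀ n ∉ Finset.Icc 1 q, n = 0 ∨ q < n := fun n hn => by
    rw [Finset.mem_Icc] at hn; omega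
  have e1 : ∑' n, primeWeight q fhat n ^ 2 = ∑ n ∈ Finset.Icc 1 q, primeWeight q fhat n ^ 2 := by
    refine tsum_eq_sum fun n hn => ?_
    rcases hnot n hn with rfl | h
    · simp
    · simp [hwfin n h]
  have e2 : ∑' n, F n = ∑ n ∈ Finset.Icc 1 q, F n := by
    refine tsum_eq_sum fun n hn => ?_
    rcases hnot n hn with rfl | h
    · simp [hFeq]
    · simp [hFeq, hbig n h]
  rw [e1, ← Finset.sum_sub_distrib, ← e2, tsum_eq_sum_tsum_prime_pow (F := F) (N := q)]
  · calc _ ≤ ∑ p ∈ (Finset.range (q + 1)).filter Nat.Prime,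
          (C / Real.log q) ^ 2 * primePowConst * (Real.log p ^ 2 / (p : ℝ) ^ 2) := by
          refine (Finset.abs_sum_le_sum_abs _ _).trans (Finset.sum_le_sum fun p hp => ?_)
          have hpp : p.Prime := (Finset.mem_filter.1 hp).2
          have hlog : ∀ a : ℕ, Real.log ((p ^ a : ℕ) : ℝ) = a * Real.log p := by
            intro a; push_cast; rw [Real.log_pow]
          refine abs_tsum_le_of_higher_prime_powers hpp (by positivity) ?_ ?_ ?_
          · simp [hFeq]
          · simp only [hFeq, hlog, vonMangoldt_apply_pow one_ne_zero, vonMangoldt_apply_prime hpp]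
            simp
          · intro a ha
            rw [hFeq, hlog, vonMangoldt_apply_pow (by omega), vonMangoldt_apply_prime hpp, abs_mul,
              abs_div, abs_mul, mul_comm, abs_pow, abs_div, abs_of_pos hL,
              Nat.abs_cast]
            have ha2 : (2 : ℝ) ≤ a := by exact_mod_cast ha
            have hp0 := Real.log_natCast_nonneg p
            push_cast
            gcongr
            · exact hC _
            · rw [abs_of_nonneg hp0, show Real.log p - a * Real.log p = -((a - 1) * Real.log p) by
                ring, abs_neg, abs_mul, abs_of_nonneg hp0, abs_of_nonneg (by linarith)]
              nlinarith [mul_nonneg (by nlinarith : (0:ℝ) ≤ a ^ 2 - (a - 1)) (sq_nonneg (Real.log p))]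
      _ ≤ _ := by
          rw [← Finset.mul_sum]
          have := primePowConst_nonneg
          gcongr
          exact sum_log_sq_div_le _
  · intro n hn
    rw [hFeq] at hn
    refine vonMangoldt_ne_zero_iff.1 fun h => hn (by simp [h])
  · intro n hn
    simp [hFeq, hbig n hn]

end Weight

theorem tendsto_log_natCast_atTop : Tendsto (fun q : ℕ => Real.log q) atTop atTop :=
  Real.tendsto_log_atTop.comp tendsto_natCast_atTop_atTop

theorem eventually_prime_and_odd :
    ∀ᶠ q in atTop ⊓ Filter.principal {q : ℕ | q.Prime ∧ Odd q}, q.Prime ∧ Odd q :=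
  mem_inf_of_right (mem_principal_self _)

theorem tendsto_tsum_primeWeight_sq {fhat : ℝ → ℝ} {α C : ℝ} (hcont : Continuous fhat)
    (hC : ∀ u, |fhat u| ≤ C) (hfhat : ∀ u, α < u → fhat u = 0) (hα : α < 1) :
    Tendsto (fun q : ℕ => ∑' n, primeWeight q fhat n ^ 2)
      (atTop ⊓ Filter.principal {q : ℕ | q.Prime ∧ Odd q})
      (nhds (∫ u in (0 : ℝ)..1, u * fhat u ^ 2)) := by
  have h1 := (tendsto_vonMangoldt_riemann_sum (h := fun u => u * fhat u ^ 2)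
    (by fun_prop)).mono_left (inf_le_left (a := atTop)
      (b := Filter.principal {q : ℕ | q.Prime ∧ Odd q}))
  have h2 : Tendsto (fun q : ℕ => (C / Real.log q) ^ 2 * primePowConst * logSqConst)
      (atTop ⊓ Filter.principal {q : ℕ | q.Prime ∧ Odd q}) (nhds 0) := by
    have := ((tendsto_log_natCast_atTop.const_div_atTop C).pow 2).mul_const
      (primePowConst * logSqConst)
    simp only [ne_eq, OfNat.ofNat_ne_zero, not_false_eq_true, zero_pow, zero_mul, ← mul_assoc]
      at this
    exact this.mono_left inf_le_left
  have h3 := squeeze_zero_norm' (f := fun q : ℕ => ∑' n, primeWeight q fhat n ^ 2 -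
    ∑ n ∈ Finset.Icc 1 q, Λ n / n / Real.log q *
      (Real.log n / Real.log q * fhat (Real.log n / Real.log q) ^ 2)) ?_ h2
  · simpa using h3.add h1
  · filter_upwards [eventually_prime_and_odd] with q ⟨hq, _⟩
    exact abs_tsum_primeWeight_sq_sub_le hq hC hfhat hα

theorem gaussMoment_continuous (k l : ℕ) : Continuous fun S => gaussMoment S k l := by
  unfold gaussMoment
  split_ifs <;> fun_prop

theorem tendsto_pairing_primeWeight {fhat : ℝ → ℝ} {α C : ℝ} (hα0 : 0 < α) (hcont : Continuous fhat)
    (hC : ∀ u, |fhat u| ≤ C) (hfhat : ∀ u, α < u → fhat u = 0) (hα : α < 1) (k l : ℕ) :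
    Tendsto (fun q : ℕ => pairing (primeWeight q fhat ^ k) (primeWeight q fhat ^ l))
      (atTop ⊓ Filter.principal {q : ℕ | q.Prime ∧ Odd q})
      (nhds (gaussMoment (∫ u in (0 : ℝ)..1, u * fhat u ^ 2) k l)) := by
  have hC0 : 0 ≤ C := (abs_nonneg _).trans (hC 0)
  have hS := tendsto_tsum_primeWeight_sq hcont hC hfhat hα
  set S := ∫ u in (0 : ℝ)..1, u * fhat u ^ 2
  have h1 := ((gaussMoment_continuous k l).tendsto S).comp hS
  obtain ⟨K, hK0, K₀, hK₀, hK⟩ := exists_abs_pairing_sub_gaussMoment_le (max k l)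
    (le_max_left 1 (|S| + 1)) (le_max_left 1 (C * (max k l : ℕ) * α))
  have hc : Tendsto (fun q : ℕ => (C / Real.log q) ^ 2)
      (atTop ⊓ Filter.principal {q : ℕ | q.Prime ∧ Odd q}) (nhds 0) := by
    have := (tendsto_log_natCast_atTop.const_div_atTop C).pow 2
    simp only [ne_eq, OfNat.ofNat_ne_zero, not_false_eq_true, zero_pow] at this
    exact this.mono_left inf_le_left
  have h3 := squeeze_zero_norm' (f := fun q : ℕ =>
    pairing (primeWeight q fhat ^ k) (primeWeight q fhat ^ l) -
      gaussMoment (∑' n, primeWeight q fhat n ^ 2) k l) ?_ (by simpa using hc.const_mul K)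
  · simpa using h3.add h1
  · have hK₀c : Tendsto (fun q : ℕ => K₀ * (C / Real.log q) ^ 2)
      (atTop ⊓ Filter.principal {q : ℕ | q.Prime ∧ Odd q}) (nhds 0) := by
      simpa using hc.const_mul K₀
    filter_upwards [eventually_prime_and_odd, hK₀c.eventually_le_const one_pos,
      hS.eventually_le_const (lt_of_le_of_lt (le_abs_self S) (lt_add_one _))] with q ⟨hq, _⟩ h4 h5
    have hL : 0 < Real.log q := Real.log_pos (by exact_mod_cast hq.one_lt)
    have hq0 : (0 : ℝ) < q := by exact_mod_cast hq.pos
    refine hK _ (C / Real.log q) ((q : ℝ) ^ α) (by positivity)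
      (Real.one_le_rpow (by exact_mod_cast hq.one_lt.le) hα0.le) (abs_primeWeight_le hC)
      (suppLe_primeWeight hq.one_lt hfhat) ?_ (h5.trans (le_max_right _ _)) h4 k (le_max_left _ _)
      l (le_max_right _ _)
    rw [Real.log_rpow hq0]
    refine le_trans (le_of_eq ?_) (le_max_right _ _)
    field_simp

theorem sum_one_div_sqrt_le (N : ℕ) : ∑ n ∈ Finset.Icc 1 N, 1 / √(n : ℝ) ≤ 2 * √N := by
  induction N with
  | zero => simp
  | succ N ih =>
    rw [Finset.sum_Icc_succ_top (by omega)]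
    have h1 : 0 < √((N + 1 : ℕ) : ℝ) := Real.sqrt_pos.2 (by positivity)
    have h2 : 1 / √((N + 1 : ℕ) : ℝ) ≤ 2 * √((N + 1 : ℕ) : ℝ) - 2 * √N := by
      rw [div_le_iff₀ h1]
      have e1 := Real.mul_self_sqrt (by positivity : (0 : ℝ) ≤ ((N + 1 : ℕ) : ℝ))
      have e2 := Real.mul_self_sqrt (by positivity : (0 : ℝ) ≤ (N : ℝ))
      push_cast at e1 e2 ⊢
      nlinarith [sq_nonneg (√((N : ℝ) + 1) - √N)]
    linarith

theorem sum_one_div_sqrt_residue_le {q : ℕ} (hq : 0 < q) (M B : ℕ) :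
    ∑ A ∈ (Finset.Icc 1 M).filter (fun A => A ≡ B [MOD q] ∧ B < A), 1 / √(A : ℝ) ≤ 2 * √M / q := by
  set s := (Finset.Icc 1 M).filter (fun A => A ≡ B [MOD q] ∧ B < A) with hs
  have hq0 : (0 : ℝ) < q := by exact_mod_cast hq
  have hmem : ∀ A ∈ s, 1 ≤ A / q ∧ A ≤ M ∧ A % q = B % q := by
    intro A hA
    simp only [hs, Finset.mem_filter, Finset.mem_Icc] at hA
    obtain ⟨⟨_, h2⟩, h3, h4⟩ := hA
    refine ⟨?_, h2, h3⟩
    rw [Nat.one_le_div_iff hq]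
    have h5 : q ∣ A - B := (Nat.modEq_iff_dvd' h4.le).1 h3.symm
    have := Nat.le_of_dvd (by omega) h5
    omega
  calc ∑ A ∈ s, 1 / √(A : ℝ) ≤ ∑ A ∈ s, 1 / √((q : ℝ) * (A / q : ℕ)) := by
        refine Finset.sum_le_sum fun A hA => ?_
        obtain ⟨h1, -, -⟩ := hmem A hA
        have : (0 : ℝ) < (A / q : ℕ) := by exact_mod_cast h1
        refine one_div_le_one_div_of_le (Real.sqrt_pos.2 (by positivity)) (Real.sqrt_le_sqrt ?_)
        exact_mod_cast Nat.mul_div_le A q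
    _ = ∑ l ∈ s.image (· / q), 1 / √((q : ℝ) * (l : ℕ)) := by
        rw [Finset.sum_image]
        intro A hA A' hA' h
        have h1 := (hmem A hA).2.2
        have h2 := (hmem A' hA').2.2
        rw [← Nat.div_add_mod A q, ← Nat.div_add_mod A' q, h1, h2]
        simp only at h
        rw [h]
    _ ≤ ∑ l ∈ Finset.Icc 1 (M / q), 1 / √((q : ℝ) * (l : ℕ)) := by
        refine Finset.sum_le_sum_of_subset_of_nonneg ?_ fun _ _ _ => by positivity
        intro l hl
        obtain ⟨A, hA, rfl⟩ := Finset.mem_image.1 hl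
        obtain ⟨h1, h2, -⟩ := hmem A hA
        exact Finset.mem_Icc.2 ⟨h1, Nat.div_le_div_right h2⟩
    _ = 1 / √q * ∑ l ∈ Finset.Icc 1 (M / q), 1 / √(l : ℝ) := by
        rw [Finset.mul_sum]
        refine Finset.sum_congr rfl fun l _ => ?_
        rw [Real.sqrt_mul hq0.le, one_div_mul_one_div]
    _ ≤ 1 / √q * (2 * √((M : ℝ) / q)) := by
        gcongr
        refine (sum_one_div_sqrt_le _).trans ?_
        gcongr
        exact Nat.cast_div_le
    _ = _ := by
        rw [Real.sqrt_div (by positivity)]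
        have := Real.mul_self_sqrt hq0.le
        have h0 : √(q : ℝ) ≠ 0 := (Real.sqrt_pos.2 hq0).ne'
        field_simp
        rw [sq, this, mul_comm]

theorem sum_sum_residue_le {q : ℕ} (hq : 0 < q) (M N : ℕ) :
    ∑ A ∈ Finset.Icc 1 M, ∑ B ∈ Finset.Icc 1 N,
      (if A ≡ B [MOD q] ∧ A ≠ B then 1 / √(A : ℝ) * (1 / √(B : ℝ)) else 0) ≤
      8 * (√M * √N) / q := by
  have half : ∀ M N : ℕ, ∑ B ∈ Finset.Icc 1 N, ∑ A ∈ Finset.Icc 1 M,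
      (if A ≡ B [MOD q] ∧ B < A then 1 / √(A : ℝ) * (1 / √(B : ℝ)) else 0) ≤
      4 * (√M * √N) / q := by
    intro M N
    calc _ = ∑ B ∈ Finset.Icc 1 N, (∑ A ∈ (Finset.Icc 1 M).filter
            (fun A => A ≡ B [MOD q] ∧ B < A), 1 / √(A : ℝ)) * (1 / √(B : ℝ)) := by
          refine Finset.sum_congr rfl fun B _ => ?_
          rw [Finset.sum_mul, Finset.sum_filter]
      _ ≤ ∑ B ∈ Finset.Icc 1 N, 2 * √M / q * (1 / √(B : ℝ)) := by
          refine Finset.sum_le_sum fun B _ => ?_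
          gcongr
          exact sum_one_div_sqrt_residue_le hq M B
      _ ≤ 2 * √M / q * (2 * √N) := by
          rw [← Finset.mul_sum]
          gcongr
          exact sum_one_div_sqrt_le N
      _ = _ := by ring
  have h1 := half M N
  have h2 := half N M
  rw [Finset.sum_comm] at h1
  calc _ = ∑ A ∈ Finset.Icc 1 M, ∑ B ∈ Finset.Icc 1 N,
        ((if A ≡ B [MOD q] ∧ B < A then 1 / √(A : ℝ) * (1 / √(B : ℝ)) else 0) +
          (if B ≡ A [MOD q] ∧ A < B then 1 / √(B : ℝ) * (1 / √(A : ℝ)) else 0)) := by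
        refine Finset.sum_congr rfl fun A _ => Finset.sum_congr rfl fun B _ => ?_
        by_cases hm : A ≡ B [MOD q]
        · rcases lt_trichotomy A B with h | h | h
          · simp [hm, hm.symm, h, h.ne, h.not_gt]; ring
          · simp [h]
          · simp [hm, h, h.ne', h.not_gt]
        · have : ¬ B ≡ A [MOD q] := fun h => hm h.symm
          simp [hm, this]
    _ ≤ 4 * (√M * √N) / q + 4 * (√N * √M) / q := by
        simp only [Finset.sum_add_distrib]
        exact add_le_add h1 h2
    _ = _ := by ring

/-- The value at `χ` of the Dirichlet polynomial with coefficients `f`. -/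
noncomputable def charSum {q : ℕ} (f : ArithmeticFunction ℝ) (χ : DirichletCharacter ℂ q) : ℂ :=
  ∑' n : ℕ, f n • χ n

theorem sum_char_mul_conj {q : ℕ} [Fact q.Prime] {a b : ZMod q} (hb : b ≠ 0) :
    ∑ χ : DirichletCharacter ℂ q, χ a * (starRingEnd ℂ) (χ b) = if a = b then ((q : ℂ) - 1) else 0 := by
  have h := DirichletCharacter.sum_char_inv_mul_char_eq ℂ (IsUnit.mk0 b hb) a
  rw [Nat.totient_prime Fact.out, Nat.cast_sub (Fact.out : q.Prime).one_lt.le, Nat.cast_one] at h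
  simp only [eq_comm (a := a)]
  rw [← h]
  refine Finset.sum_congr rfl fun χ _ => ?_
  rw [mul_comm]
  congr 1
  rw [← MulChar.inv_apply', ← MulChar.star_apply']
  rfl

open scoped Classical in
theorem sum_charSum_mul_conj {q : ℕ} [Fact q.Prime] {f g : ArithmeticFunction ℝ} {M N : ℕ}
    (hf : SuppLe f M) (hg : SuppLe g N) (hfq : ∀ n, q ∣ n → f n = 0) (hgq : ∀ n, q ∣ n → g n = 0) :
    ∑ χ ∈ Finset.univ.filter (fun χ : DirichletCharacter ℂ q => χ ≠ 1),
      charSum f χ * (starRingEnd ℂ) (charSum g χ) =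
    (((q - 1 : ℝ) * ∑ A ∈ Finset.Icc 1 M, ∑ B ∈ Finset.Icc 1 N,
      (if A ≡ B [MOD q] then f A * g B else 0) -
      (∑ A ∈ Finset.Icc 1 M, f A) * ∑ B ∈ Finset.Icc 1 N, g B : ℝ) : ℂ) := by
  have hexp : ∀ χ : DirichletCharacter ℂ q, charSum f χ * (starRingEnd ℂ) (charSum g χ) =
      ∑ A ∈ Finset.Icc 1 M, ∑ B ∈ Finset.Icc 1 N,
        ((f A * g B : ℝ) : ℂ) * (χ A * (starRingEnd ℂ) (χ B)) := by
    intro χ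
    rw [charSum, charSum, hf.tsum_eq (fun n : ℕ => χ n) le_rfl,
      hg.tsum_eq (fun n : ℕ => χ n) le_rfl, map_sum, Finset.sum_mul_sum]
    refine Finset.sum_congr rfl fun A _ => Finset.sum_congr rfl fun B _ => ?_
    rw [Complex.real_smul, Complex.real_smul, map_mul, Complex.conj_ofReal]
    push_cast; ring
  have hone : charSum f (1 : DirichletCharacter ℂ q) *
      (starRingEnd ℂ) (charSum g (1 : DirichletCharacter ℂ q)) =
      (((∑ A ∈ Finset.Icc 1 M, f A) * ∑ B ∈ Finset.Icc 1 N, g B : ℝ) : ℂ) := by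
    have h1 : ∀ {f : ArithmeticFunction ℝ} {M : ℕ}, SuppLe f M → (∀ n, q ∣ n → f n = 0) →
        charSum f (1 : DirichletCharacter ℂ q) = ((∑ A ∈ Finset.Icc 1 M, f A : ℝ) : ℂ) := by
      intro f M hf hfq
      rw [charSum, hf.tsum_eq (fun n : ℕ => (1 : DirichletCharacter ℂ q) n) le_rfl]
      push_cast
      refine Finset.sum_congr rfl fun A _ => ?_
      by_cases hA : q ∣ A
      · simp [hfq A hA]
      · rw [MulChar.one_apply, Complex.real_smul, mul_one]
        exact IsUnit.mk0 _ fun h => hA ((ZMod.natCast_eq_zero_iff _ _).1 h)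
    rw [h1 hf hfq, h1 hg hgq, Complex.conj_ofReal, Complex.ofReal_mul]
  rw [Finset.filter_ne', Finset.sum_erase_eq_sub (Finset.mem_univ _), hone, Complex.ofReal_sub]
  congr 1
  simp only [hexp]
  rw [Finset.sum_comm, Complex.ofReal_mul, Complex.ofReal_sum, Finset.mul_sum]
  refine Finset.sum_congr rfl fun A _ => ?_
  rw [Finset.sum_comm, Complex.ofReal_sum, Finset.mul_sum]
  refine Finset.sum_congr rfl fun B _ => ?_
  rw [← Finset.mul_sum]
  by_cases hB : q ∣ B
  · simp [hgq B hB]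
  · rw [sum_char_mul_conj fun h => hB ((ZMod.natCast_eq_zero_iff _ _).1 h)]
    simp only [ZMod.natCast_eq_natCast_iff]
    split_ifs <;> push_cast <;> ring

theorem abs_diag_add_offDiag_sub_pairing_le {q : ℕ} (hq3 : 3 ≤ q)
    {f g : ArithmeticFunction ℝ} {M N : ℕ}
    (hf : SuppLe f M) (hg : SuppLe g N)
    {c d : ℝ} (hc : ∀ n, |f n| ≤ c / √n) (hd : ∀ n, |g n| ≤ d / √n) :
    |1 / (q - 2 : ℝ) * ((q - 1 : ℝ) * ∑ A ∈ Finset.Icc 1 M, ∑ B ∈ Finset.Icc 1 N,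
      (if A ≡ B [MOD q] then f A * g B else 0) -
      (∑ A ∈ Finset.Icc 1 M, f A) * ∑ B ∈ Finset.Icc 1 N, g B) - pairing f g| ≤
      (3 * |pairing f g| + 28 * (c * d) * (√M * √N)) / q := by
  have hqr : (3 : ℝ) ≤ q := by exact_mod_cast hq3
  have hc0 : 0 ≤ c := by simpa using (abs_nonneg _).trans (hc 1)
  have hd0 : 0 ≤ d := by simpa using (abs_nonneg _).trans (hd 1)
  have hsum : ∀ {f : ArithmeticFunction ℝ} {c : ℝ} (M : ℕ), 0 ≤ c → (∀ n, |f n| ≤ c / √n) →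
      |∑ A ∈ Finset.Icc 1 M, f A| ≤ c * (2 * √M) := by
    intro f c M hc0 hc
    calc _ ≤ ∑ A ∈ Finset.Icc 1 M, c * (1 / √(A : ℝ)) := by
          refine (Finset.abs_sum_le_sum_abs _ _).trans (Finset.sum_le_sum fun A _ => ?_)
          rw [mul_one_div]; exact hc A
      _ ≤ _ := by
          rw [← Finset.mul_sum]
          gcongr
          exact sum_one_div_sqrt_le M
  set T := (∑ A ∈ Finset.Icc 1 M, f A) * ∑ B ∈ Finset.Icc 1 N, g B with hT
  have hTb : |T| ≤ 4 * (c * d) * (√M * √N) := by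
    rw [hT, abs_mul]
    calc _ ≤ (c * (2 * √M)) * (d * (2 * √N)) := by
          gcongr
          · exact hsum M hc0 hc
          · exact hsum N hd0 hd
      _ = _ := by ring
  set O := ∑ A ∈ Finset.Icc 1 M, ∑ B ∈ Finset.Icc 1 N,
      (if A ≡ B [MOD q] ∧ A ≠ B then f A * g B else 0) with hO
  have hOb : |O| ≤ 8 * (c * d) * (√M * √N) / q := by
    calc |O| ≤ ∑ A ∈ Finset.Icc 1 M, ∑ B ∈ Finset.Icc 1 N, (c * d) *
          (if A ≡ B [MOD q] ∧ A ≠ B then 1 / √(A : ℝ) * (1 / √(B : ℝ)) else 0) := by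
          refine (Finset.abs_sum_le_sum_abs _ _).trans (Finset.sum_le_sum fun A _ => ?_)
          refine (Finset.abs_sum_le_sum_abs _ _).trans (Finset.sum_le_sum fun B _ => ?_)
          split_ifs
          · rw [abs_mul]
            calc _ ≤ (c / √A) * (d / √B) := by
                  gcongr
                  · exact hc A
                  · exact hd B
              _ = _ := by ring
          · simp
      _ ≤ (c * d) * (8 * (√M * √N) / q) := by
          simp only [← Finset.mul_sum]
          gcongr
          exact sum_sum_residue_le (by omega) M N
      _ = _ := by ring
  have hD : ∑ A ∈ Finset.Icc 1 M, ∑ B ∈ Finset.Icc 1 N,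
      (if A ≡ B [MOD q] then f A * g B else 0) = pairing f g + O := by
    have e := hf.tsum_eq (fun n => g n) le_rfl
    simp only [smul_eq_mul] at e
    rw [pairing, e, hO, ← Finset.sum_add_distrib]
    refine Finset.sum_congr rfl fun A hA => ?_
    have : f A * g A = ∑ B ∈ Finset.Icc 1 N, if A = B then f A * g B else 0 := by
      rw [Finset.sum_ite_eq]
      split_ifs with h
      · rfl
      · rw [hg A, mul_zero]
        rw [Finset.mem_Icc] at hA h
        exact_mod_cast (by omega : N < A)
    rw [this, ← Finset.sum_add_distrib]
    refine Finset.sum_congr rfl fun B _ => ?_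
    by_cases h : A = B
    · subst h; simp [Nat.ModEq.refl]
    · simp [h]
  rw [hD]
  have h2 : (0 : ℝ) < q - 2 := by linarith
  have h3 : 1 / (q - 2 : ℝ) ≤ 3 / q := by
    rw [div_le_div_iff₀ h2 (by linarith)]; linarith
  have h4 : (q - 1 : ℝ) / (q - 2) ≤ 2 := by
    rw [div_le_iff₀ h2]; linarith
  have h5 : (0 : ℝ) ≤ (q - 1 : ℝ) / (q - 2) := div_nonneg (by linarith) h2.le
  have e : 1 / (q - 2 : ℝ) * ((q - 1) * (pairing f g + O) - T) - pairing f g =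
      1 / (q - 2 : ℝ) * pairing f g + (q - 1) / (q - 2) * O - 1 / (q - 2 : ℝ) * T := by
    field_simp; ring
  rw [e]
  calc _ ≤ |1 / (q - 2 : ℝ) * pairing f g| + |(q - 1) / (q - 2) * O| + |1 / (q - 2 : ℝ) * T| :=
        (abs_sub _ _).trans (by gcongr; exact abs_add_le _ _)
    _ ≤ 3 / q * |pairing f g| + 2 * (8 * (c * d) * (√M * √N) / q) +
          3 / q * (4 * (c * d) * (√M * √N)) := by
        rw [abs_mul, abs_mul, abs_mul, abs_of_nonneg h5, abs_of_pos (one_div_pos.2 h2)]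
        gcongr
    _ = _ := by ring

theorem Wosc_eq {q : ℕ} (hq : q.Prime) {fhat : ℝ → ℝ} {α : ℝ} (hfhat : ∀ u, α < u → fhat u = 0)
    (χ : DirichletCharacter ℂ q) : (Wosc q fhat χ : ℂ) =
      -(charSum (primeWeight q fhat) χ + (starRingEnd ℂ) (charSum (primeWeight q fhat) χ)) := by
  have : Fact q.Prime := ⟨hq⟩
  obtain ⟨M, hM⟩ := exists_nat_ge ((q : ℝ) ^ α)
  have hw := suppLe_primeWeight hq.one_lt hfhat
  have h1 : Wosc q fhat χ =
      -∑' n : ℕ, primeWeight q fhat n • (χ n + (starRingEnd ℂ) (χ n)).re := by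
    rw [Wosc, neg_mul, ← tsum_mul_left]
    congr 1
    refine tsum_congr fun n => ?_
    rw [primeWeight_apply, smul_eq_mul]
    split_ifs with h
    · have : χ n = 0 := by
        rw [(ZMod.natCast_eq_zero_iff n q).2 h]
        exact χ.map_nonunit not_isUnit_zero
      simp [this]
    · ring
  rw [h1, charSum, hw.tsum_eq (fun n : ℕ => (χ n + (starRingEnd ℂ) (χ n)).re) hM,
    hw.tsum_eq (fun n : ℕ => χ n) hM, map_sum, ← Finset.sum_add_distrib]
  push_cast
  congr 1
  refine Finset.sum_congr rfl fun n _ => ?_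
  rw [Complex.real_smul, map_mul, Complex.conj_ofReal, ← mul_add, Complex.add_conj, smul_eq_mul,
    Complex.ofReal_re]
  push_cast
  rfl

theorem charSum_pow {q : ℕ} {f : ArithmeticFunction ℝ} {X : ℝ} (hf : SuppLe f X)
    (hX : 0 ≤ X) (χ : DirichletCharacter ℂ q) (k : ℕ) : charSum (f ^ k) χ = charSum f χ ^ k :=
  tsum_pow_smul hf hX (fun n : ℕ => χ n) (fun a b => by push_cast; exact map_mul χ _ _) (by simp) k

/-- The average of a product of two Dirichlet polynomials over the nontrivial characters,
evaluated by orthogonality. -/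
noncomputable def charCorrelation (q : ℕ) (f g : ArithmeticFunction ℝ) (M N : ℕ) : ℝ :=
  1 / (q - 2 : ℝ) * ((q - 1 : ℝ) * ∑ A ∈ Finset.Icc 1 M, ∑ B ∈ Finset.Icc 1 N,
      (if A ≡ B [MOD q] then f A * g B else 0) -
      (∑ A ∈ Finset.Icc 1 M, f A) * ∑ B ∈ Finset.Icc 1 N, g B)

theorem SuppLe.floor {f : ArithmeticFunction ℝ} {X : ℝ} (hf : SuppLe f X) : SuppLe f ⌊X⌋₊ :=
  fun n hn => hf n (Nat.lt_of_floor_lt (by exact_mod_cast hn))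

theorem charAvg_Wosc_pow_eq {q : ℕ} (hq : q.Prime) {fhat : ℝ → ℝ} {α : ℝ}
    (hfhat : ∀ u, α < u → fhat u = 0) (m : ℕ) :
    charAvg q (fun χ => Wosc q fhat χ ^ m) =
      (-1) ^ m * ∑ k ∈ Finset.range (m + 1), m.choose k *
        charCorrelation q (primeWeight q fhat ^ k) (primeWeight q fhat ^ (m - k))
          ⌊((q : ℝ) ^ α) ^ k⌋₊ ⌊((q : ℝ) ^ α) ^ (m - k)⌋₊ := by
  have : Fact q.Prime := ⟨hq⟩
  have hX : (0 : ℝ) ≤ (q : ℝ) ^ α := by positivity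
  have hw := suppLe_primeWeight hq.one_lt hfhat
  apply Complex.ofReal_injective
  rw [charAvg]
  push_cast
  have hW : ∀ χ : DirichletCharacter ℂ q, (Wosc q fhat χ : ℂ) ^ m =
      (-1) ^ m * ∑ k ∈ Finset.range (m + 1), (m.choose k : ℂ) *
        (charSum (primeWeight q fhat ^ k) χ *
          (starRingEnd ℂ) (charSum (primeWeight q fhat ^ (m - k)) χ)) := by
    intro χ
    rw [Wosc_eq hq hfhat, neg_pow, add_pow]
    congr 1
    refine Finset.sum_congr rfl fun k _ => ?_
    rw [charSum_pow hw hX, charSum_pow hw hX, map_pow]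
    ring
  simp only [hW]
  rw [← Finset.mul_sum, Finset.sum_comm, mul_left_comm, Finset.mul_sum]
  congr 1
  refine Finset.sum_congr rfl fun k _ => ?_
  rw [← Finset.mul_sum, mul_left_comm]
  congr 1
  rw [charCorrelation, Complex.ofReal_mul]
  congr 1
  · push_cast; rfl
  · convert sum_charSum_mul_conj (hw.pow hX k).floor (hw.pow hX (m - k)).floor
      (pow_eq_zero_of_dvd hq primeWeight_eq_zero_of_dvd k)
      (pow_eq_zero_of_dvd hq primeWeight_eq_zero_of_dvd (m - k))

theorem abs_primeWeight_pow_le {q : ℕ} (hq : 1 < q) {fhat : ℝ → ℝ} {C α : ℝ} (hα : 0 ≤ α)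
    (hC : ∀ u, |fhat u| ≤ C) (hfhat : ∀ u, α < u → fhat u = 0) (k n : ℕ) :
    |(primeWeight q fhat ^ k) n| ≤ (C * α * k) ^ k / √n := by
  have hq0 : (0 : ℝ) < q := by exact_mod_cast (by omega : 0 < q)
  have hL : 0 < Real.log q := Real.log_pos (by exact_mod_cast hq)
  have hC0 : 0 ≤ C := (abs_nonneg _).trans (hC 0)
  have hX : (0 : ℝ) ≤ (q : ℝ) ^ α := by positivity
  by_cases hn : ((q : ℝ) ^ α) ^ k < n
  · rw [(suppLe_primeWeight hq hfhat).pow hX k n hn, abs_zero]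
    positivity
  rcases Nat.eq_zero_or_pos n with rfl | hn0
  · simp
  have h1 : Real.log n ≤ k * (α * Real.log q) := by
    rw [← Real.log_rpow hq0, ← Real.log_pow]
    exact Real.log_le_log (by exact_mod_cast hn0) (not_lt.1 hn)
  have h0 := Real.log_natCast_nonneg n
  calc _ ≤ (C / Real.log q) ^ k * (Real.log n ^ k / √n) :=
        abs_pow_apply_le (by positivity) (abs_primeWeight_le hC) k n
    _ = (C / Real.log q * Real.log n) ^ k / √n := by ring
    _ ≤ (C / Real.log q * (k * (α * Real.log q))) ^ k / √n := by gcongr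
    _ = _ := by congr 2; field_simp

theorem tendsto_charCorrelation {fhat : ℝ → ℝ} {C α S : ℝ} (hα : 0 ≤ α)
    (hC : ∀ u, |fhat u| ≤ C) (hfhat : ∀ u, α < u → fhat u = 0) (k l : ℕ)
    (hkl : ((k + l : ℕ) : ℝ) * α < 2)
    (h : Tendsto (fun q : ℕ => pairing (primeWeight q fhat ^ k) (primeWeight q fhat ^ l))
      (atTop ⊓ Filter.principal {q : ℕ | q.Prime ∧ Odd q}) (nhds S)) :
    Tendsto (fun q : ℕ => charCorrelation q (primeWeight q fhat ^ k) (primeWeight q fhat ^ l)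
        ⌊((q : ℝ) ^ α) ^ k⌋₊ ⌊((q : ℝ) ^ α) ^ l⌋₊)
      (atTop ⊓ Filter.principal {q : ℕ | q.Prime ∧ Odd q}) (nhds S) := by
  have hC0 : 0 ≤ C := (abs_nonneg _).trans (hC 0)
  set E := 28 * ((C * α * k) ^ k * (C * α * l) ^ l) with hE
  have hE0 : 0 ≤ E := by positivity
  have hinv : Tendsto (fun q : ℕ => (q : ℝ)⁻¹)
      (atTop ⊓ Filter.principal {q : ℕ | q.Prime ∧ Odd q}) (nhds 0) :=
    (tendsto_inv_atTop_zero.comp tendsto_natCast_atTop_atTop).mono_left inf_le_left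
  have hpow : Tendsto (fun q : ℕ => (q : ℝ) ^ (-(1 - (k + l : ℕ) * α / 2)))
      (atTop ⊓ Filter.principal {q : ℕ | q.Prime ∧ Odd q}) (nhds 0) :=
    ((tendsto_rpow_neg_atTop (by linarith)).comp tendsto_natCast_atTop_atTop).mono_left inf_le_left
  have hlim : Tendsto (fun q : ℕ =>
      3 * |pairing (primeWeight q fhat ^ k) (primeWeight q fhat ^ l)| * (q : ℝ)⁻¹ +
        E * (q : ℝ) ^ (-(1 - (k + l : ℕ) * α / 2)))
      (atTop ⊓ Filter.principal {q : ℕ | q.Prime ∧ Odd q}) (nhds 0) := by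
    simpa using ((h.abs.const_mul 3).mul hinv).add (hpow.const_mul E)
  have h3 := squeeze_zero_norm' (f := fun q : ℕ =>
    charCorrelation q (primeWeight q fhat ^ k) (primeWeight q fhat ^ l)
        ⌊((q : ℝ) ^ α) ^ k⌋₊ ⌊((q : ℝ) ^ α) ^ l⌋₊ -
      pairing (primeWeight q fhat ^ k) (primeWeight q fhat ^ l)) ?_ hlim
  · simpa using h3.add h
  filter_upwards [eventually_prime_and_odd] with q ⟨hq, hodd⟩
  have hq0 : (0 : ℝ) < q := by exact_mod_cast hq.pos
  have hX : (0 : ℝ) ≤ (q : ℝ) ^ α := by positivity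
  have hw := suppLe_primeWeight hq.one_lt hfhat
  have hq3 : 3 ≤ q := by
    have := hq.two_le
    obtain ⟨r, hr⟩ := hodd
    omega
  refine (abs_diag_add_offDiag_sub_pairing_le hq3 (hw.pow hX k).floor (hw.pow hX l).floor
    (abs_primeWeight_pow_le hq.one_lt hα hC hfhat k)
    (abs_primeWeight_pow_le hq.one_lt hα hC hfhat l)).trans ?_
  rw [add_div, div_eq_mul_inv (3 * _)]
  gcongr
  have hs : √(⌊((q : ℝ) ^ α) ^ k⌋₊ : ℝ) * √(⌊((q : ℝ) ^ α) ^ l⌋₊ : ℝ) ≤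
      (q : ℝ) ^ ((k + l : ℕ) * α / 2) := by
    rw [← Real.sqrt_mul (by positivity)]
    calc _ ≤ √(((q : ℝ) ^ α) ^ k * ((q : ℝ) ^ α) ^ l) := by
          gcongr <;> exact Nat.floor_le (by positivity)
      _ = _ := by
          rw [← pow_add, ← Real.rpow_mul_natCast hq0.le, Real.sqrt_eq_rpow,
            ← Real.rpow_mul hq0.le]
          congr 1; ring
  calc _ ≤ E * (q : ℝ) ^ ((k + l : ℕ) * α / 2) / q := by gcongr
    _ = E * ((q : ℝ) ^ ((k + l : ℕ) * α / 2) / (q : ℝ) ^ (1 : ℝ)) := by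
        rw [Real.rpow_one, mul_div_assoc]
    _ = _ := by
        rw [← Real.rpow_sub hq0]
        congr 2; ring

theorem fourier_even {f fhat : ℝ → ℝ} (heven : ∀ x, f (-x) = f x)
    (hfourier : ∀ u : ℝ, (fhat u : ℂ) =
      ∫ x : ℝ, (f x : ℂ) * Complex.exp (-(2 * Real.pi * Complex.I) * x * u)) (u : ℝ) :
    fhat (-u) = fhat u := by
  apply Complex.ofReal_injective
  rw [hfourier, hfourier, ← MeasureTheory.integral_neg_eq_self]
  refine MeasureTheory.integral_congr_ae (.of_forall fun x => ?_)
  simp only [heven]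
  congr 2
  push_cast; ring

theorem integral_abs_mul_sq {fhat : ℝ → ℝ} (hcont : Continuous fhat) (h : ∀ u, fhat (-u) = fhat u) :
    ∫ u in (-1 : ℝ)..1, |u| * fhat u ^ 2 = 2 * ∫ u in (0 : ℝ)..1, u * fhat u ^ 2 := by
  have hi : ∀ a b : ℝ, IntervalIntegrable (fun u => |u| * fhat u ^ 2) MeasureTheory.volume a b :=
    fun a b => Continuous.intervalIntegrable (by fun_prop) a b
  have h1 : ∫ u in (0 : ℝ)..1, |u| * fhat u ^ 2 = ∫ u in (0 : ℝ)..1, u * fhat u ^ 2 := by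
    refine intervalIntegral.integral_congr fun u hu => ?_
    rw [Set.uIcc_of_le zero_le_one] at hu
    simp only [abs_of_nonneg hu.1]
  have h2 : ∫ u in (-1 : ℝ)..0, |u| * fhat u ^ 2 = ∫ u in (0 : ℝ)..1, |u| * fhat u ^ 2 := by
    have := intervalIntegral.integral_comp_neg (a := 0) (b := 1) fun u : ℝ => |u| * fhat u ^ 2
    simp only [abs_neg, h, neg_zero] at this
    exact this.symm
  rw [← intervalIntegral.integral_add_adjacent_intervals (hi (-1) 0) (hi 0 1), h2, h1, two_mul]

theorem sum_choose_mul_gaussMoment (S : ℝ) (m : ℕ) :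
    (-1) ^ m * ∑ k ∈ Finset.range (m + 1), (m.choose k : ℝ) * gaussMoment S k (m - k) =
      if Odd m then 0
        else (m.factorial : ℝ) / (2 ^ (m / 2) * (m / 2).factorial) * (2 * S) ^ (m / 2) := by
  split_ifs with hm
  · rw [Finset.sum_eq_zero, mul_zero]
    intro k hk
    rw [Finset.mem_range] at hk
    rw [gaussMoment, if_neg, mul_zero]
    rintro h
    obtain ⟨r, hr⟩ := hm
    omega
  · obtain ⟨r, rfl⟩ := (Nat.not_odd_iff_even.1 hm)
    rw [Finset.sum_eq_single r]
    · have e : (r + r) / 2 = r := by omega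
      have h1 := Nat.add_choose_mul_factorial_mul_factorial r r
      have h2 : ((r + r).choose r : ℝ) * r.factorial * r.factorial = (r + r).factorial := by
        exact_mod_cast h1
      have h3 : (r.factorial : ℝ) ≠ 0 := by positivity
      rw [e, gaussMoment, if_pos (by omega), ← h2, (Even.add_self r).neg_one_pow, mul_pow]
      field_simp
    · intro k _ hk
      rw [gaussMoment, if_neg (by omega), mul_zero]
    · intro h; simp at h

/-- Mock-Gaussian moments: if `f` is real and even with `f̂` continuous and supported in
`[-α, α]`, and `m < 2/α`, then `⟨(W_f^osc)^m⟩_q` converges, as `q → ∞` through odd primes,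
to `0` for odd `m` and to `(m!/(2^{m/2} (m/2)!)) σ(f)^m` for even `m`, where
`σ(f)² = ∫_{-1}^{1} |u| f̂(u)² du`. -/
theorem charAvg_Wosc_pow_tendsto (f fhat : ℝ → ℝ) (heven : ∀ x, f (-x) = f x)
    (hcont : Continuous fhat) (α : ℝ) (hα : 0 < α)
    (hsupp : Function.support fhat ⊆ Set.Icc (-α) α)
    (hfourier : ∀ u : ℝ, (fhat u : ℂ) =
      ∫ x : ℝ, (f x : ℂ) * Complex.exp (-(2 * Real.pi * Complex.I) * x * u))
    (m : ℕ) (hm : 1 ≤ m) (hmα : (m : ℝ) < 2 / α) :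
    Tendsto (fun q : ℕ => charAvg q (fun χ => (Wosc q fhat χ) ^ m))
      (atTop ⊓ Filter.principal {q : ℕ | q.Prime ∧ Odd q})
      (nhds (if Odd m then 0
        else (m.factorial : ℝ) / (2 ^ (m / 2) * (m / 2).factorial) *
          (∫ u in (-1 : ℝ)..1, |u| * fhat u ^ 2) ^ (m / 2))) := by
  have hfhat : ∀ u, α < u → fhat u = 0 := by
    intro u hu
    by_contra h
    exact absurd (hsupp h).2 (not_le.2 hu)
  obtain ⟨C, hC⟩ := hcont.bounded_above_of_compact_support
    (HasCompactSupport.of_support_subset_isCompact isCompact_Icc hsupp)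
  have hmα' : (m : ℝ) * α < 2 := (lt_div_iff₀ hα).1 hmα
  rw [integral_abs_mul_sq hcont (fourier_even heven hfourier), ← sum_choose_mul_gaussMoment]
  have hpair : ∀ k ≤ m, Tendsto
      (fun q : ℕ => pairing (primeWeight q fhat ^ k) (primeWeight q fhat ^ (m - k)))
      (atTop ⊓ Filter.principal {q : ℕ | q.Prime ∧ Odd q})
      (nhds (gaussMoment (∫ u in (0 : ℝ)..1, u * fhat u ^ 2) k (m - k))) := by
    intro k hk
    rcases hm.eq_or_lt with rfl | hm2
    · have h1 : ∀ q, primeWeight q fhat 1 = 0 := fun q => apply_one_eq_zero (abs_primeWeight_le hC)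
      have h0 : k = 0 ∨ k = 1 := by omega
      rcases h0 with rfl | rfl
      · simpa [gaussMoment, pairing_one_left, h1] using tendsto_const_nhds
      · simpa [gaussMoment, pairing_one_right, h1] using tendsto_const_nhds
    · have hm2' : (2 : ℝ) ≤ m := by exact_mod_cast hm2
      exact tendsto_pairing_primeWeight hα hcont hC hfhat (by nlinarith) k (m - k)
  refine Tendsto.congr' ?_ (Tendsto.const_mul ((-1) ^ m) (tendsto_finsetSum
    (Finset.range (m + 1)) fun k hk => (tendsto_charCorrelation hα.le hC hfhat k (m - k) ?_
      (hpair k (by rw [Finset.mem_range] at hk; omega))).const_mul (m.choose k : ℝ)))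
  · filter_upwards [eventually_prime_and_odd] with q ⟨hq, _⟩
    exact (charAvg_Wosc_pow_eq hq hfhat m).symm
  · rw [Finset.mem_range] at hk
    rwa [show k + (m - k) = m by omega]
end

section
/- There is an absolute constant C such that for all positive integers q and all reals X, Y with 1 ≤ X ≤ q and X ≤ Y, one has Σ 1/√(M·N) ≤ C·√(X·Y)/q, where the sum runs over pairs of positive integers (M, N) with M ≤ X, N ≤ Y, M ≠ N and M ≡ N (mod q). Moreover, if in addition Y < q, then there are no such pairs and the sum is zero. -/
theorem sum_Icc_one_div_sqrt_le (n : ℕ) :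
    ∑ k ∈ Finset.Icc 1 n, 1 / Real.sqrt k ≤ 2 * Real.sqrt n := by
  induction n with
  | zero => simp
  | succ n ih =>
    rw [Finset.sum_Icc_succ_top (by omega)]
    have ha : 0 ≤ Real.sqrt n := Real.sqrt_nonneg _
    have hb : 0 < Real.sqrt ((n + 1 : ℕ) : ℝ) := Real.sqrt_pos.2 (by positivity)
    have ha2 : Real.sqrt n ^ 2 = n := Real.sq_sqrt (by positivity)
    have hb2 : Real.sqrt ((n + 1 : ℕ) : ℝ) ^ 2 = n + 1 := by
      rw [Real.sq_sqrt (by positivity)]; push_cast; ring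
    have key : 1 / Real.sqrt ((n + 1 : ℕ) : ℝ) ≤
        2 * Real.sqrt ((n + 1 : ℕ) : ℝ) - 2 * Real.sqrt n := by
      rw [div_le_iff₀ hb]
      nlinarith [sq_nonneg (Real.sqrt ((n + 1 : ℕ) : ℝ) - Real.sqrt n)]
    linarith

/-- A positive integer congruent to, but different from, `M ≤ q` exceeds `M` by a
positive multiple of `q`. -/
theorem exists_eq_add_mul_of_modEq {q M N : ℕ} (hMq : M ≤ q) (hN : 1 ≤ N)
    (hne : M ≠ N) (h : M ≡ N [MOD q]) : ∃ k, 1 ≤ k ∧ N = M + k * q := by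
  rcases lt_or_gt_of_ne hne with hlt | hlt
  · obtain ⟨k, hk⟩ := (Nat.modEq_iff_dvd' hlt.le).1 h
    refine ⟨k, Nat.one_le_iff_ne_zero.2 ?_, ?_⟩
    · rintro rfl
      omega
    · rw [mul_comm]
      omega
  · have := Nat.le_of_dvd (by omega) ((Nat.modEq_iff_dvd' hlt.le).1 h.symm)
    omega

theorem sum_inv_sqrt_modEq_le {q M : ℕ} (hM : 1 ≤ M) (hMq : M ≤ q) (n : ℕ) :
    ∑ N ∈ (Finset.Icc 1 n).filter (fun N => M ≠ N ∧ M ≡ N [MOD q]), 1 / Real.sqrt (M * N) ≤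
      2 * Real.sqrt n / q * (1 / Real.sqrt M) := by
  have hq : 0 < q := by omega
  have hsub : (Finset.Icc 1 n).filter (fun N => M ≠ N ∧ M ≡ N [MOD q]) ⊆
      (Finset.Icc 1 (n / q)).image (fun k => M + k * q) := by
    intro N hN
    simp only [Finset.mem_filter, Finset.mem_Icc] at hN
    obtain ⟨⟨hN1, hNn⟩, hne, h⟩ := hN
    obtain ⟨k, hk, rfl⟩ := exists_eq_add_mul_of_modEq hMq hN1 hne h
    refine Finset.mem_image.2 ⟨k, Finset.mem_Icc.2 ⟨hk, ?_⟩, rfl⟩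
    rw [Nat.le_div_iff_mul_le hq]
    omega
  have hinj : Function.Injective (fun k : ℕ => M + k * q) := fun a b hab =>
    Nat.eq_of_mul_eq_mul_right hq (Nat.add_left_cancel hab)
  have hq' : (0 : ℝ) < q := by exact_mod_cast hq
  have hM' : (0 : ℝ) < M := by exact_mod_cast hM
  have hsqrt : Real.sqrt ((n / q : ℕ) : ℝ) ≤ Real.sqrt n / Real.sqrt q := by
    rw [← Real.sqrt_div' _ hq'.le]
    exact Real.sqrt_le_sqrt Nat.cast_div_le
  calc _ ≤ ∑ N ∈ (Finset.Icc 1 (n / q)).image (fun k => M + k * q), 1 / Real.sqrt (M * N) :=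
        Finset.sum_le_sum_of_subset_of_nonneg hsub fun _ _ _ => by positivity
    _ = ∑ k ∈ Finset.Icc 1 (n / q), 1 / Real.sqrt (M * ((M + k * q : ℕ) : ℝ)) :=
        Finset.sum_image hinj.injOn
    _ ≤ ∑ k ∈ Finset.Icc 1 (n / q), 1 / Real.sqrt M * (1 / Real.sqrt q) * (1 / Real.sqrt k) := by
        refine Finset.sum_le_sum fun k hk => ?_
        have hk' : (0 : ℝ) < k := by exact_mod_cast (Finset.mem_Icc.1 hk).1
        rw [one_div_mul_one_div, one_div_mul_one_div, ← Real.sqrt_mul hM'.le,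
          ← Real.sqrt_mul (by positivity)]
        refine one_div_le_one_div_of_le (Real.sqrt_pos.2 (by positivity)) (Real.sqrt_le_sqrt ?_)
        push_cast
        nlinarith [mul_pos hM' hM']
    _ ≤ 1 / Real.sqrt M * (1 / Real.sqrt q) * (2 * (Real.sqrt n / Real.sqrt q)) := by
        rw [← Finset.mul_sum]
        gcongr
        exact (sum_Icc_one_div_sqrt_le _).trans (by gcongr)
    _ = 2 * Real.sqrt n / (Real.sqrt q * Real.sqrt q) * (1 / Real.sqrt M) := by
        field_simp
    _ = _ := by rw [Real.mul_self_sqrt hq'.le]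


open scoped Classical in
/-- For `1 ≤ X ≤ q` and `X ≤ Y`, the sum of `1/√(M·N)` over pairs of positive integers
`M ≤ X`, `N ≤ Y` with `M ≠ N` and `M ≡ N (mod q)` is at most `C·√(XY)/q`;
moreover if `Y < q` the sum is empty, hence zero. -/
theorem sum_inv_sqrt_congruent_pairs :
    ∃ C : ℝ, ∀ q : ℕ, 0 < q → ∀ X Y : ℝ, 1 ≤ X → X ≤ q → X ≤ Y →
      (∑ M ∈ Finset.Icc 1 ⌊X⌋₊, ∑ N ∈ Finset.Icc 1 ⌊Y⌋₊,
          if M ≠ N ∧ M ≡ N [MOD q] then 1 / Real.sqrt (M * N) else 0) ≤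
        C * Real.sqrt (X * Y) / q ∧
      (Y < q →
        (∑ M ∈ Finset.Icc 1 ⌊X⌋₊, ∑ N ∈ Finset.Icc 1 ⌊Y⌋₊,
          if M ≠ N ∧ M ≡ N [MOD q] then 1 / Real.sqrt (M * N) else 0) = 0) := by
  refine ⟨4, fun q hq X Y hX hXq hXY => ?_⟩
  have hMq : ∀ M ∈ Finset.Icc 1 ⌊X⌋₊, 1 ≤ M ∧ M ≤ q := fun M hM =>
    ⟨(Finset.mem_Icc.1 hM).1, (Finset.mem_Icc.1 hM).2.trans (Nat.floor_le_of_le hXq)⟩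
  refine ⟨?_, fun hYq => ?_⟩
  · calc _ ≤ ∑ M ∈ Finset.Icc 1 ⌊X⌋₊, 2 * Real.sqrt ⌊Y⌋₊ / q * (1 / Real.sqrt M) := by
          refine Finset.sum_le_sum fun M hM => ?_
          rw [← Finset.sum_filter]
          convert sum_inv_sqrt_modEq_le (hMq M hM).1 (hMq M hM).2 ⌊Y⌋₊
      _ ≤ 2 * Real.sqrt Y / q * (2 * Real.sqrt X) := by
          rw [← Finset.mul_sum]
          have hXf : Real.sqrt ⌊X⌋₊ ≤ Real.sqrt X :=
            Real.sqrt_le_sqrt (Nat.floor_le (by linarith))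
          have hYf : Real.sqrt ⌊Y⌋₊ ≤ Real.sqrt Y :=
            Real.sqrt_le_sqrt (Nat.floor_le (by linarith))
          have hsum := (sum_Icc_one_div_sqrt_le ⌊X⌋₊).trans
            (mul_le_mul_of_nonneg_left hXf zero_le_two)
          gcongr
      _ = _ := by
          rw [Real.sqrt_mul (by linarith)]
          ring
  · refine Finset.sum_eq_zero fun M hM => Finset.sum_eq_zero fun N hN => if_neg ?_
    rintro ⟨hne, h⟩
    obtain ⟨hN1, hNY⟩ := Finset.mem_Icc.1 hN
    obtain ⟨k, hk, rfl⟩ := exists_eq_add_mul_of_modEq (hMq M hM).2 hN1 hne h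
    have hlt : ⌊Y⌋₊ < q := (Nat.floor_lt (by linarith)).2 hYq
    have := Nat.le_mul_of_pos_left q hk
    omega
end

section
/- Let m ≥ 1 be an integer, let r, s ≥ 0 with r + s = m, let 0 < α < 2/m, and let ε > 0. Then there is a constant C = C(m, α, ε) such that for every prime q ≥ 3, (1/(log q)^m) · Σ ∏_{i=1}^r (Λ(n_i)/√{n_i}) · ∏_{j=1}^s (Λ(m_j)/√{m_j}) ≤ C · q^{mα/2 − 1 + ε}, where the sum runs over all tuples of integers n_1, …, n_r, m_1, …, m_s in [2, q^α] such that ∏_i n_i ≡ ∏_j m_j (mod q) but ∏_i n_i ≠ ∏_j m_j. -/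
open ArithmeticFunction

theorem sum_piFinset_fin_succ {M : Type*} [AddCommMonoid M] {β : Type*} (k : ℕ) (S : Finset β)
    (f : (Fin (k + 1) → β) → M) :
    ∑ n ∈ Fintype.piFinset (fun _ : Fin (k + 1) => S), f n =
      ∑ a ∈ S, ∑ n ∈ Fintype.piFinset (fun _ : Fin k => S), f (Fin.cons a n) := by
  rw [← Finset.sum_product']
  symm
  refine Finset.sum_equiv (Fin.consEquiv fun _ => β) ?_ ?_
  · rintro ⟨a, n⟩
    simp [Fintype.mem_piFinset, Fin.forall_fin_succ, Fin.consEquiv]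
  · rintro ⟨a, n⟩ _
    rfl

/-- The `k`-fold Dirichlet convolution of `Λ` is bounded by the `k`-th power of `log`. -/
theorem sum_prod_vonMangoldt_le_log_pow (k : ℕ) (S : Finset ℕ) {N : ℕ} (hN : N ≠ 0) :
    ∑ n ∈ Fintype.piFinset (fun _ : Fin k => S), (if ∏ i, n i = N then ∏ i, Λ (n i) else 0) ≤
      Real.log N ^ k := by
  induction k generalizing N with
  | zero =>
    simp only [Fintype.piFinset_of_isEmpty, Finset.univ_unique, Finset.sum_singleton,
      Finset.univ_eq_empty, Finset.prod_empty, pow_zero]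
    split_ifs <;> norm_num
  | succ k ih =>
    have hlog : 0 ≤ Real.log N := Real.log_natCast_nonneg N
    have hstep : ∀ a ∈ S,
        ∑ n ∈ Fintype.piFinset (fun _ : Fin k => S),
          (if a * ∏ i, n i = N then Λ a * ∏ i, Λ (n i) else 0) ≤
        if a ∈ N.divisors then Λ a * Real.log N ^ k else 0 := by
      intro a _
      split_ifs with ha
      · obtain ⟨b, rfl⟩ := Nat.dvd_of_mem_divisors ha
        have ha0 : a ≠ 0 := left_ne_zero_of_mul hN
        have hb0 : b ≠ 0 := right_ne_zero_of_mul hN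
        have hb : Real.log b ≤ Real.log (a * b : ℕ) :=
          Real.log_le_log (by positivity)
            (by exact_mod_cast Nat.le_mul_of_pos_left b (Nat.pos_of_ne_zero ha0))
        calc _ = Λ a * ∑ n ∈ Fintype.piFinset (fun _ : Fin k => S),
                (if ∏ i, n i = b then ∏ i, Λ (n i) else 0) := by
              rw [Finset.mul_sum]
              refine Finset.sum_congr rfl fun n _ => ?_
              simp [mul_right_inj' ha0, mul_ite]
          _ ≤ Λ a * Real.log (a * b : ℕ) ^ k := by
              refine mul_le_mul_of_nonneg_left ?_ vonMangoldt_nonneg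
              exact (ih hb0).trans (pow_le_pow_left₀ (Real.log_natCast_nonneg b) hb k)
      · refine (Finset.sum_eq_zero fun n _ => if_neg fun h => ha ?_).le
        exact Nat.mem_divisors.2 ⟨⟨_, h.symm⟩, hN⟩
    rw [sum_piFinset_fin_succ]
    simp only [Fin.prod_univ_succ, Fin.cons_zero, Fin.cons_succ]
    calc _ ≤ ∑ a ∈ S, if a ∈ N.divisors then Λ a * Real.log N ^ k else 0 :=
          Finset.sum_le_sum hstep
      _ = ∑ a ∈ S with a ∈ N.divisors, Λ a * Real.log N ^ k := (Finset.sum_filter _ _).symm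
      _ ≤ ∑ a ∈ N.divisors, Λ a * Real.log N ^ k :=
          Finset.sum_le_sum_of_subset_of_nonneg (fun a ha => (Finset.mem_filter.1 ha).2)
            fun a _ _ => mul_nonneg vonMangoldt_nonneg (pow_nonneg hlog k)
      _ = Real.log N ^ (k + 1) := by
          rw [← Finset.sum_mul, vonMangoldt_sum, pow_succ']

/-- A sum over tuples weighted by `Λ(n)/√n` is controlled by the sum over their products. -/
theorem sum_prod_vonMangoldt_div_sqrt_mul_le (k M : ℕ) (h : ℕ → ℝ) (hh : ∀ A, 0 ≤ h A) :
    ∑ n ∈ Fintype.piFinset (fun _ : Fin k => Finset.Icc 2 M),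
        (∏ i, Λ (n i) / √(n i)) * h (∏ i, n i) ≤
      Real.log (M ^ k : ℕ) ^ k * ∑ A ∈ Finset.Icc 1 (M ^ k), h A / √A := by
  have hmaps : ∀ n ∈ Fintype.piFinset (fun _ : Fin k => Finset.Icc 2 M),
      ∏ i, n i ∈ Finset.Icc 1 (M ^ k) := by
    intro n hn
    have hn' : ∀ i, 2 ≤ n i ∧ n i ≤ M := fun i =>
      Finset.mem_Icc.1 (Fintype.mem_piFinset.1 hn i)
    refine Finset.mem_Icc.2 ⟨Nat.one_le_iff_ne_zero.2 (Finset.prod_ne_zero_iff.2 fun i _ => ?_), ?_⟩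
    · have := (hn' i).1
      omega
    · simpa using Finset.prod_le_prod' (s := Finset.univ) fun i _ => (hn' i).2
  rw [← Finset.sum_fiberwise_of_maps_to hmaps, Finset.mul_sum]
  refine Finset.sum_le_sum fun A hA => ?_
  obtain ⟨hA1, hA2⟩ := Finset.mem_Icc.1 hA
  have hA0 : A ≠ 0 := by omega
  calc _ = ∑ n ∈ Fintype.piFinset (fun _ : Fin k => Finset.Icc 2 M) with ∏ i, n i = A,
          (∏ i, Λ (n i)) * (h A / √A) := by
        refine Finset.sum_congr rfl fun n hn => ?_
        have hnA := (Finset.mem_filter.1 hn).2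
        have hsqrt : ∏ i, √(n i : ℝ) = √(A : ℝ) := by
          rw [← hnA, Nat.cast_prod, Real.sqrt_prod _ fun i _ => Nat.cast_nonneg _]
        rw [Finset.prod_div_distrib, hsqrt, hnA]
        ring
    _ = (∑ n ∈ Fintype.piFinset (fun _ : Fin k => Finset.Icc 2 M),
          if ∏ i, n i = A then ∏ i, Λ (n i) else 0) * (h A / √A) := by
        rw [← Finset.sum_mul, Finset.sum_filter]
    _ ≤ Real.log (M ^ k : ℕ) ^ k * (h A / √A) := by
        refine mul_le_mul_of_nonneg_right ?_ (div_nonneg (hh A) (Real.sqrt_nonneg _))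
        refine (sum_prod_vonMangoldt_le_log_pow k _ hA0).trans ?_
        refine pow_le_pow_left₀ (Real.log_natCast_nonneg A) ?_ k
        exact Real.log_le_log (by positivity) (by exact_mod_cast hA2)

theorem sum_inv_sqrt_le (N : ℕ) : ∑ k ∈ Finset.Icc 1 N, 1 / √(k : ℝ) ≤ 2 * √(N : ℝ) := by
  induction N with
  | zero => simp
  | succ N ih =>
    rw [Finset.sum_Icc_succ_top (by omega)]
    have h1 : 0 < √((N + 1 : ℕ) : ℝ) := Real.sqrt_pos.2 (by positivity)
    have h2 : √((N + 1 : ℕ) : ℝ) ^ 2 = N + 1 := by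
      rw [Real.sq_sqrt (by positivity)]; push_cast; ring
    have h3 : √(N : ℝ) ^ 2 = N := Real.sq_sqrt (by positivity)
    have h4 : 1 / √((N + 1 : ℕ) : ℝ) ≤ 2 * √((N + 1 : ℕ) : ℝ) - 2 * √(N : ℝ) := by
      rw [div_le_iff₀ h1]
      nlinarith [sq_nonneg (√((N + 1 : ℕ) : ℝ) - √(N : ℝ))]
    linarith

theorem sum_inv_sqrt_modEq_lt_le {q : ℕ} (hq : 0 < q) (B X : ℕ) :
    ∑ A ∈ Finset.Icc 1 X with A ≡ B [MOD q] ∧ B < A, 1 / √(A : ℝ) ≤ 2 * √(X : ℝ) / q := by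
  have hsub : {A ∈ Finset.Icc 1 X | A ≡ B [MOD q] ∧ B < A} ⊆
      (Finset.Icc 1 (X / q)).image fun k => B + k * q := by
    intro A hA
    obtain ⟨hAX, hAB, hlt⟩ := Finset.mem_filter.1 hA
    obtain ⟨k, hk⟩ := (Nat.modEq_iff_dvd' hlt.le).1 hAB.symm
    have hA' : A = B + k * q := by rw [mul_comm k q]; omega
    have hk0 : k ≠ 0 := by rintro rfl; omega
    refine Finset.mem_image.2 ⟨k, Finset.mem_Icc.2 ⟨by omega, ?_⟩, hA'.symm⟩
    rw [Nat.le_div_iff_mul_le hq]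
    have := (Finset.mem_Icc.1 hAX).2
    omega
  have hq' : (0 : ℝ) < q := by exact_mod_cast hq
  calc _ ≤ ∑ A ∈ (Finset.Icc 1 (X / q)).image fun k => B + k * q, 1 / √(A : ℝ) :=
        Finset.sum_le_sum_of_subset_of_nonneg hsub fun _ _ _ => by positivity
    _ = ∑ k ∈ Finset.Icc 1 (X / q), 1 / √((B + k * q : ℕ) : ℝ) := by
        refine Finset.sum_image fun a _ b _ hab => ?_
        exact Nat.eq_of_mul_eq_mul_right hq (Nat.add_left_cancel hab)
    _ ≤ ∑ k ∈ Finset.Icc 1 (X / q), 1 / √(k : ℝ) * (1 / √(q : ℝ)) := by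
        refine Finset.sum_le_sum fun k hk => ?_
        have hk1 : (0 : ℝ) < k := by exact_mod_cast (Finset.mem_Icc.1 hk).1
        rw [one_div_mul_one_div, ← Real.sqrt_mul hk1.le]
        gcongr
        push_cast
        nlinarith [(Nat.cast_nonneg B : (0 : ℝ) ≤ B)]
    _ ≤ 2 * √((X / q : ℕ) : ℝ) * (1 / √(q : ℝ)) := by
        rw [← Finset.sum_mul]
        gcongr
        exact sum_inv_sqrt_le _
    _ ≤ 2 * √((X : ℝ) / q) * (1 / √(q : ℝ)) := by
        gcongr
        exact Nat.cast_div_le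
    _ = 2 * √(X : ℝ) / q := by
        rw [Real.sqrt_div' _ hq'.le]
        field_simp
        rw [Real.sq_sqrt hq'.le]

theorem sum_sum_modEq_lt_le {q : ℕ} (hq : 0 < q) (X Y : ℕ) :
    ∑ B ∈ Finset.Icc 1 Y, ∑ A ∈ Finset.Icc 1 X,
      (if A ≡ B [MOD q] ∧ B < A then 1 / √(A : ℝ) * (1 / √(B : ℝ)) else 0) ≤
      4 * (√(X : ℝ) * √(Y : ℝ)) / q := by
  calc _ = ∑ B ∈ Finset.Icc 1 Y,
        (∑ A ∈ Finset.Icc 1 X with A ≡ B [MOD q] ∧ B < A, 1 / √(A : ℝ)) * (1 / √(B : ℝ)) := by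
        refine Finset.sum_congr rfl fun B _ => ?_
        rw [Finset.sum_mul, Finset.sum_filter]
    _ ≤ ∑ B ∈ Finset.Icc 1 Y, 2 * √(X : ℝ) / q * (1 / √(B : ℝ)) := by
        gcongr
        exact sum_inv_sqrt_modEq_lt_le hq _ _
    _ ≤ 2 * √(X : ℝ) / q * (2 * √(Y : ℝ)) := by
        rw [← Finset.mul_sum]
        gcongr
        exact sum_inv_sqrt_le _
    _ = _ := by ring

open scoped Classical in
theorem sum_sum_modEq_ne_le {q : ℕ} (hq : 0 < q) (X Y : ℕ) :
    ∑ A ∈ Finset.Icc 1 X, ∑ B ∈ Finset.Icc 1 Y,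
      (if A ≡ B [MOD q] ∧ A ≠ B then 1 / √(A : ℝ) * (1 / √(B : ℝ)) else 0) ≤
      8 * (√(X : ℝ) * √(Y : ℝ)) / q := by
  have h1 := sum_sum_modEq_lt_le hq X Y
  have h2 := sum_sum_modEq_lt_le hq Y X
  rw [Finset.sum_comm] at h1
  calc _ = ∑ A ∈ Finset.Icc 1 X, ∑ B ∈ Finset.Icc 1 Y,
          ((if A ≡ B [MOD q] ∧ B < A then 1 / √(A : ℝ) * (1 / √(B : ℝ)) else 0) +
          (if B ≡ A [MOD q] ∧ A < B then 1 / √(B : ℝ) * (1 / √(A : ℝ)) else 0)) := by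
        refine Finset.sum_congr rfl fun A _ => Finset.sum_congr rfl fun B _ => ?_
        simp only [Nat.ModEq.comm (a := B)]
        rcases lt_trichotomy A B with h | rfl | h
        · simp [h, h.ne, h.not_gt, mul_comm]
        · simp
        · simp [h, h.ne', h.not_gt]
    _ ≤ _ := by
        simp only [Finset.sum_add_distrib]
        refine (add_le_add h1 h2).trans_eq ?_
        ring

open ArithmeticFunction in
open scoped Classical in
/-- Congruential (non-equal) terms are negligible: for `r + s = m`, `0 < α < 2/m`, `ε > 0`,
the sum over tuples `n_i, m_j ∈ [2, q^α]` with `∏ n_i ≡ ∏ m_j (mod q)` but `∏ n_i ≠ ∏ m_j`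
of `∏ Λ(n_i)/√n_i · ∏ Λ(m_j)/√m_j`, divided by `(log q)^m`, is `O(q^{mα/2 - 1 + ε})`. -/
theorem congruential_terms_bound (m r s : ℕ) (hm : 1 ≤ m) (hrs : r + s = m)
    (α ε : ℝ) (hα : 0 < α) (hα2 : (m : ℝ) * α < 2) (hε : 0 < ε) :
    ∃ C : ℝ, ∀ q : ℕ, q.Prime → 3 ≤ q →
      (1 / (Real.log q) ^ m) *
        ∑ n ∈ Fintype.piFinset (fun _ : Fin r => Finset.Icc 2 ⌊(q : ℝ) ^ α⌋₊),
          ∑ l ∈ Fintype.piFinset (fun _ : Fin s => Finset.Icc 2 ⌊(q : ℝ) ^ α⌋₊),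
            (if (∏ i, n i) ≡ (∏ j, l j) [MOD q] ∧ (∏ i, n i) ≠ (∏ j, l j)
              then (∏ i, Λ (n i) / Real.sqrt (n i)) * ∏ j, Λ (l j) / Real.sqrt (l j)
              else 0) ≤
      C * (q : ℝ) ^ ((m : ℝ) * α / 2 - 1 + ε) := by
  refine ⟨8 * (m * α) ^ m, fun q _ hq3 => ?_⟩
  have hq0 : 0 < q := by omega
  have hq : (0 : ℝ) < q := by exact_mod_cast hq0
  have hq1 : (1 : ℝ) ≤ q := by exact_mod_cast hq0
  have hL : 0 < Real.log q := Real.log_pos (by exact_mod_cast (by omega : 1 < q))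
  set M := ⌊(q : ℝ) ^ α⌋₊
  have hMle : (M : ℝ) ≤ (q : ℝ) ^ α := Nat.floor_le (by positivity)
  have hM0 : 0 < M := Nat.floor_pos.2 (Real.one_le_rpow hq1 hα.le)
  have hlogM : Real.log M ≤ α * Real.log q := by
    rw [← Real.log_rpow hq]
    exact Real.log_le_log (by exact_mod_cast hM0) hMle
  have hlog : ∀ k ≤ m, Real.log (M ^ k : ℕ) ^ k ≤ (m * α * Real.log q) ^ k := by
    intro k hk
    refine pow_le_pow_left₀ (Real.log_natCast_nonneg _) ?_ k
    rw [Nat.cast_pow, Real.log_pow, mul_assoc]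
    have : (k : ℝ) ≤ m := by exact_mod_cast hk
    have := Real.log_natCast_nonneg M
    gcongr
  have hsum : ∑ n ∈ Fintype.piFinset (fun _ : Fin r => Finset.Icc 2 M),
      ∑ l ∈ Fintype.piFinset (fun _ : Fin s => Finset.Icc 2 M),
        (if (∏ i, n i) ≡ (∏ j, l j) [MOD q] ∧ (∏ i, n i) ≠ (∏ j, l j)
          then (∏ i, Λ (n i) / √(n i)) * ∏ j, Λ (l j) / √(l j) else 0) ≤
      (m * α * Real.log q) ^ m * (8 * (√((M ^ r : ℕ) : ℝ) * √((M ^ s : ℕ) : ℝ)) / q) := by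
    let c : ℕ → ℕ → ℝ := fun A B => if A ≡ B [MOD q] ∧ A ≠ B then 1 else 0
    have hc : ∀ A B, 0 ≤ c A B := fun A B => by dsimp only [c]; split_ifs <;> norm_num
    calc _ = ∑ n ∈ Fintype.piFinset (fun _ : Fin r => Finset.Icc 2 M),
          (∏ i, Λ (n i) / √(n i)) * ∑ l ∈ Fintype.piFinset (fun _ : Fin s => Finset.Icc 2 M),
            (∏ j, Λ (l j) / √(l j)) * c (∏ i, n i) (∏ j, l j) := by
          simp only [Finset.mul_sum, c, mul_ite, mul_one, mul_zero]
      _ ≤ ∑ n ∈ Fintype.piFinset (fun _ : Fin r => Finset.Icc 2 M),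
          (∏ i, Λ (n i) / √(n i)) * (Real.log (M ^ s : ℕ) ^ s *
            ∑ B ∈ Finset.Icc 1 (M ^ s), c (∏ i, n i) B / √B) := by
          refine Finset.sum_le_sum fun n _ => mul_le_mul_of_nonneg_left ?_ ?_
          · exact sum_prod_vonMangoldt_div_sqrt_mul_le s M _ (hc _)
          · exact Finset.prod_nonneg fun i _ => div_nonneg vonMangoldt_nonneg (Real.sqrt_nonneg _)
      _ ≤ Real.log (M ^ r : ℕ) ^ r * ∑ A ∈ Finset.Icc 1 (M ^ r), (Real.log (M ^ s : ℕ) ^ s *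
            ∑ B ∈ Finset.Icc 1 (M ^ s), c A B / √B) / √A := by
          refine sum_prod_vonMangoldt_div_sqrt_mul_le r M (fun A => Real.log (M ^ s : ℕ) ^ s *
            ∑ B ∈ Finset.Icc 1 (M ^ s), c A B / √B) fun A => ?_
          exact mul_nonneg (pow_nonneg (Real.log_natCast_nonneg _) _)
            (Finset.sum_nonneg fun B _ => div_nonneg (hc _ _) (Real.sqrt_nonneg _))
      _ = Real.log (M ^ r : ℕ) ^ r * Real.log (M ^ s : ℕ) ^ s *
          ∑ A ∈ Finset.Icc 1 (M ^ r), ∑ B ∈ Finset.Icc 1 (M ^ s),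
            (if A ≡ B [MOD q] ∧ A ≠ B then 1 / √(A : ℝ) * (1 / √(B : ℝ)) else 0) := by
          simp only [Finset.mul_sum, Finset.sum_div]
          refine Finset.sum_congr rfl fun A _ => Finset.sum_congr rfl fun B _ => ?_
          dsimp only [c]
          split_ifs <;> ring
      _ ≤ (m * α * Real.log q) ^ r * (m * α * Real.log q) ^ s *
          (8 * (√((M ^ r : ℕ) : ℝ) * √((M ^ s : ℕ) : ℝ)) / q) := by
          have hr := hlog r (by omega)
          have hs := hlog s (by omega)
          have hr0 := pow_nonneg (Real.log_natCast_nonneg (M ^ r)) r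
          have hs0 := pow_nonneg (Real.log_natCast_nonneg (M ^ s)) s
          refine mul_le_mul (mul_le_mul hr hs hs0 (hr0.trans hr)) (sum_sum_modEq_ne_le hq0 _ _)
            ?_ (by positivity)
          exact Finset.sum_nonneg fun A _ => Finset.sum_nonneg fun B _ => by
            split_ifs <;> positivity
      _ = _ := by rw [← pow_add, hrs]
  have hsqrt : √((M ^ r : ℕ) : ℝ) * √((M ^ s : ℕ) : ℝ) ≤ (q : ℝ) ^ ((m : ℝ) * α / 2) := by
    rw [← Real.sqrt_mul (Nat.cast_nonneg _), Nat.cast_pow, Nat.cast_pow, ← pow_add, hrs]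
    refine Real.sqrt_le_iff.2 ⟨by positivity, ?_⟩
    calc (M : ℝ) ^ m ≤ ((q : ℝ) ^ α) ^ m := by gcongr
      _ = ((q : ℝ) ^ ((m : ℝ) * α / 2)) ^ 2 := by
        rw [← Real.rpow_mul_natCast hq.le, ← Real.rpow_mul_natCast hq.le]
        congr 1
        push_cast
        ring
  calc _ ≤ 1 / Real.log q ^ m *
        ((m * α * Real.log q) ^ m * (8 * (q : ℝ) ^ ((m : ℝ) * α / 2) / q)) := by
        gcongr
        refine hsum.trans ?_
        gcongr
    _ = 8 * (m * α) ^ m * (q : ℝ) ^ ((m : ℝ) * α / 2 - 1) := by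
        rw [Real.rpow_sub_one hq.ne', mul_pow _ (Real.log q)]
        field_simp
    _ ≤ 8 * (m * α) ^ m * (q : ℝ) ^ ((m : ℝ) * α / 2 - 1 + ε) := by
        gcongr
        linarith
end

section
/- Let g: ℝ → ℝ be continuous and compactly supported. Then, as the real parameter Q → ∞, (1/(log Q)²) · Σ_{n=2}^∞ (Λ(n)²/n) · g(log n / log Q)² converges to ∫_0^∞ u · g(u)² du. -/
open ArithmeticFunction Finset in
/-- Mertens' first theorem for the von Mangoldt function, lower bound. -/
theorem log_sub_one_le_sum_vonMangoldt_div {N : ℕ} (hN : N ≠ 0) :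
    Real.log N - 1 ≤ ∑ n ∈ Ioc 0 N, Λ n / n := by
  have hN' : (0 : ℝ) < N := by exact_mod_cast Nat.pos_of_ne_zero hN
  have hfact : ∑ n ∈ Ioc 0 N, Λ n * ((N / n : ℕ) : ℝ) = Real.log (N.factorial) := by
    rw [← sum_Ioc_mul_zeta_eq_sum, vonMangoldt_mul_zeta]
    simp only [log_apply]
    rw [← Finset.prod_Ico_id_eq_factorial, Nat.cast_prod, ← Order.succ_eq_add_one,
      show Ico 1 (Order.succ N) = Ioc 0 N by ext; simp; lia, Real.log_prod]
    intro i hi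
    have := (mem_Ioc.1 hi).1
    positivity
  have hle : ∑ n ∈ Ioc 0 N, Λ n * ((N / n : ℕ) : ℝ) ≤ N * ∑ n ∈ Ioc 0 N, Λ n / n := by
    rw [mul_sum]
    refine sum_le_sum fun n _ => ?_
    calc Λ n * ((N / n : ℕ) : ℝ) ≤ Λ n * ((N : ℝ) / n) :=
          mul_le_mul_of_nonneg_left Nat.cast_div_le vonMangoldt_nonneg
      _ = N * (Λ n / n) := by ring
  have hst := Stirling.le_log_factorial_stirling hN
  have h1 : 0 ≤ Real.log N := Real.log_natCast_nonneg N
  have h2 : 0 ≤ Real.log (2 * Real.pi) := Real.log_nonneg (by nlinarith [Real.pi_gt_three])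
  refine le_of_mul_le_mul_left ?_ hN'
  nlinarith

open ArithmeticFunction Finset in
/-- Mertens' first theorem for the von Mangoldt function, upper bound. -/
theorem sum_vonMangoldt_div_le_log_add {N : ℕ} (hN : N ≠ 0) :
    ∑ n ∈ Ioc 0 N, Λ n / n ≤ Real.log N + (Real.log 4 + 4) := by
  have hN' : (0 : ℝ) < N := by exact_mod_cast Nat.pos_of_ne_zero hN
  have hfact : ∑ n ∈ Ioc 0 N, Λ n * ((N / n : ℕ) : ℝ) ≤ N * Real.log N := by
    rw [← sum_Ioc_mul_zeta_eq_sum, vonMangoldt_mul_zeta]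
    calc ∑ n ∈ Ioc 0 N, log n ≤ ∑ _n ∈ Ioc 0 N, Real.log N := by
          refine sum_le_sum fun n hn => ?_
          have hn := mem_Ioc.1 hn
          have : (0 : ℝ) < n := by exact_mod_cast hn.1
          exact Real.log_le_log this (by exact_mod_cast hn.2)
      _ = N * Real.log N := by simp
  have hpsi : ∑ n ∈ Ioc 0 N, Λ n ≤ (Real.log 4 + 4) * N := by
    simpa [Chebyshev.psi] using Chebyshev.psi_le_const_mul_self hN'.le
  have hle : N * ∑ n ∈ Ioc 0 N, Λ n / n ≤
      ∑ n ∈ Ioc 0 N, Λ n * ((N / n : ℕ) : ℝ) + ∑ n ∈ Ioc 0 N, Λ n := by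
    rw [mul_sum, ← sum_add_distrib]
    refine sum_le_sum fun n hn => ?_
    have hfl : (N : ℝ) / n ≤ ((N / n : ℕ) : ℝ) + 1 := by
      rw [← Nat.floor_div_eq_div (K := ℝ)]
      exact (Nat.lt_floor_add_one _).le
    calc N * (Λ n / n) = Λ n * ((N : ℝ) / n) := by ring
      _ ≤ Λ n * (((N / n : ℕ) : ℝ) + 1) := mul_le_mul_of_nonneg_left hfl vonMangoldt_nonneg
      _ = _ := by ring
  refine le_of_mul_le_mul_left ?_ hN'
  linarith

open ArithmeticFunction Finset Filter in
theorem tendsto_inv_mul_sum_vonMangoldt_div {t : ℝ} (ht : 0 ≤ t) :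
    Tendsto (fun L : ℝ => L⁻¹ * ∑ n ∈ Ioc 0 ⌊Real.exp (t * L)⌋₊, Λ n / n) atTop (nhds t) := by
  have hlow : Tendsto (fun L : ℝ => t - (1 + Real.log 2) * L⁻¹) atTop (nhds t) := by
    simpa using tendsto_const_nhds.sub (tendsto_inv_atTop_zero.const_mul (1 + Real.log 2))
  have hup : Tendsto (fun L : ℝ => t + (Real.log 4 + 4) * L⁻¹) atTop (nhds t) := by
    simpa using tendsto_const_nhds.add (tendsto_inv_atTop_zero.const_mul (Real.log 4 + 4))
  refine tendsto_of_tendsto_of_tendsto_of_le_of_le' hlow hup ?_ ?_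
  all_goals
    filter_upwards [eventually_gt_atTop 0] with L hL
    have hx : 1 ≤ Real.exp (t * L) := Real.one_le_exp (by positivity)
    have hfl : 1 ≤ ⌊Real.exp (t * L)⌋₊ := Nat.one_le_floor_iff _ |>.2 hx
    have hfl' : (1 : ℝ) ≤ ⌊Real.exp (t * L)⌋₊ := by exact_mod_cast hfl
  · have h := log_sub_one_le_sum_vonMangoldt_div (N := ⌊Real.exp (t * L)⌋₊) (by lia)
    have h1 : Real.exp (t * L) ≤ 2 * ⌊Real.exp (t * L)⌋₊ := by
      linarith [Nat.lt_floor_add_one (Real.exp (t * L))]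
    have h2 := Real.log_le_log (Real.exp_pos _) h1
    rw [Real.log_exp, Real.log_mul (by norm_num) (by positivity)] at h2
    calc t - (1 + Real.log 2) * L⁻¹ = L⁻¹ * (t * L - (1 + Real.log 2)) := by
          field_simp
      _ ≤ _ := mul_le_mul_of_nonneg_left (by linarith) (by positivity)
  · have h := sum_vonMangoldt_div_le_log_add (N := ⌊Real.exp (t * L)⌋₊) (by lia)
    have h2 := Real.log_le_log (by positivity) (Nat.floor_le (Real.exp_pos (t * L)).le)
    rw [Real.log_exp] at h2
    calc _ ≤ L⁻¹ * (t * L + (Real.log 4 + 4)) :=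
          mul_le_mul_of_nonneg_left (by linarith) (by positivity)
      _ = _ := by field_simp

open Finset in
theorem log_div_mem_Icc_of_mem_Ioc_floor_exp {a b L : ℝ} (hL : 0 < L) {n : ℕ}
    (hn : n ∈ Ioc ⌊Real.exp (a * L)⌋₊ ⌊Real.exp (b * L)⌋₊) :
    Real.log n / L ∈ Set.Icc a b := by
  obtain ⟨h1, h2⟩ := mem_Ioc.1 hn
  have hn0 : (0 : ℝ) < n := by exact_mod_cast (Nat.zero_le _).trans_lt h1
  have h1' := Nat.lt_of_floor_lt h1
  have h2' := (Nat.le_floor_iff (Real.exp_pos _).le).1 h2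
  rw [Set.mem_Icc, le_div_iff₀ hL, div_le_iff₀ hL]
  exact ⟨(Real.le_log_iff_exp_le hn0).2 h1'.le, (Real.log_le_iff_le_exp hn0).2 h2'⟩

open Finset Filter in
theorem eventually_abs_sum_sub_integral_lt {c : ℕ → ℝ} (hc0 : ∀ n, 0 ≤ c n)
    (hc : ∀ t : ℝ, 0 ≤ t →
      Tendsto (fun L : ℝ => L⁻¹ * ∑ n ∈ Ioc 0 ⌊Real.exp (t * L)⌋₊, c n) atTop (nhds t))
    {h : ℝ → ℝ} (hh : Continuous h) {a b y ε : ℝ} (ha : 0 ≤ a) (hab : a < b) (hε : 0 < ε)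
    (hy : ∀ u ∈ Set.Icc a b, |h u - y| ≤ ε) :
    ∀ᶠ L : ℝ in atTop,
      |L⁻¹ * ∑ n ∈ Ioc ⌊Real.exp (a * L)⌋₊ ⌊Real.exp (b * L)⌋₊, c n * h (Real.log n / L) -
        ∫ u in a..b, h u| < 3 * ε * (b - a) := by
  set D : ℝ → ℝ := fun L => L⁻¹ * ∑ n ∈ Ioc ⌊Real.exp (a * L)⌋₊ ⌊Real.exp (b * L)⌋₊, c n with hD
  have hDlim : Tendsto D atTop (nhds (b - a)) := by
    refine ((hc b (ha.trans hab.le)).sub (hc a ha)).congr' ?_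
    filter_upwards [eventually_gt_atTop 0] with L hL
    have hmono : ⌊Real.exp (a * L)⌋₊ ≤ ⌊Real.exp (b * L)⌋₊ := by gcongr
    rw [← sum_Ioc_consecutive c (Nat.zero_le _) hmono]
    simp only [hD]
    ring
  have hlim : Tendsto (fun L => ε * D L + |y| * |D L - (b - a)| + ε * (b - a)) atTop
      (nhds (2 * ε * (b - a))) := by
    have := ((hDlim.const_mul ε).add
      (((hDlim.sub_const (b - a)).abs).const_mul |y|)).add_const (ε * (b - a))
    convert this using 2
    simp
    ring
  have hlt : 2 * ε * (b - a) < 3 * ε * (b - a) := by nlinarith [mul_pos hε (sub_pos.2 hab)]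
  filter_upwards [hlim.eventually_lt_const hlt, eventually_gt_atTop 0] with L hL hL0
  refine lt_of_le_of_lt ?_ hL
  have hint : |(∫ u in a..b, h u) - y * (b - a)| ≤ ε * (b - a) := by
    have h1 : (∫ u in a..b, h u) - y * (b - a) = ∫ u in a..b, (h u - y) := by
      rw [intervalIntegral.integral_sub (hh.intervalIntegrable _ _) (by simp)]
      simp [mul_comm]
    rw [h1]
    have := intervalIntegral.norm_integral_le_of_norm_le_const (a := a) (b := b) (C := ε)
      (f := fun u => h u - y) (fun u hu => by
        rw [Set.uIoc_of_le hab.le] at hu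
        exact hy u ⟨hu.1.le, hu.2⟩)
    rwa [abs_of_pos (sub_pos.2 hab)] at this
  have hsum : |L⁻¹ * ∑ n ∈ Ioc ⌊Real.exp (a * L)⌋₊ ⌊Real.exp (b * L)⌋₊,
      c n * h (Real.log n / L) - y * D L| ≤ ε * D L := by
    have h1 : L⁻¹ * ∑ n ∈ Ioc ⌊Real.exp (a * L)⌋₊ ⌊Real.exp (b * L)⌋₊,
        c n * h (Real.log n / L) - y * D L =
        L⁻¹ * ∑ n ∈ Ioc ⌊Real.exp (a * L)⌋₊ ⌊Real.exp (b * L)⌋₊,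
          c n * (h (Real.log n / L) - y) := by
      simp only [hD, mul_sub, sum_sub_distrib, ← sum_mul]
      ring
    rw [h1, abs_mul, abs_of_pos (inv_pos.2 hL0)]
    calc _ ≤ L⁻¹ * ∑ n ∈ Ioc ⌊Real.exp (a * L)⌋₊ ⌊Real.exp (b * L)⌋₊, c n * ε := by
          refine mul_le_mul_of_nonneg_left ?_ (inv_pos.2 hL0).le
          refine (abs_sum_le_sum_abs _ _).trans (sum_le_sum fun n hn => ?_)
          rw [abs_mul, abs_of_nonneg (hc0 n)]
          exact mul_le_mul_of_nonneg_left
            (hy _ (log_div_mem_Icc_of_mem_Ioc_floor_exp hL0 hn)) (hc0 n)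
      _ = ε * D L := by rw [← sum_mul]; simp only [hD]; ring
  have hmid : |y * D L - y * (b - a)| = |y| * |D L - (b - a)| := by rw [← mul_sub, abs_mul]
  rw [← hmid]
  rw [abs_sub_comm] at hint
  exact (abs_sub_le _ (y * (b - a)) _).trans
    (add_le_add ((abs_sub_le _ (y * D L) _).trans (add_le_add hsum le_rfl)) hint)

open Finset in
theorem sum_range_sum_Ioc {M : Type*} [AddCommMonoid M] (f : ℕ → M) {m : ℕ → ℕ}
    (hm : Monotone m) (k : ℕ) :
    ∑ j ∈ range k, ∑ n ∈ Ioc (m j) (m (j + 1)), f n = ∑ n ∈ Ioc (m 0) (m k), f n := by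
  induction k with
  | zero => simp
  | succ k ih =>
    rw [sum_range_succ, ih, sum_Ioc_consecutive f (hm (Nat.zero_le k)) (hm k.le_succ)]

open Finset Filter in
/-- If the weights `c n`, placed at `log n / L` and scaled by `1 / L`, give asymptotic mass `t` to
each interval `(-∞, t]`, then the corresponding sums of a uniformly continuous function converge to
its integral. -/
theorem tendsto_inv_mul_sum_mul_comp_log_div {c : ℕ → ℝ} (hc0 : ∀ n, 0 ≤ c n)
    (hc : ∀ t : ℝ, 0 ≤ t →
      Tendsto (fun L : ℝ => L⁻¹ * ∑ n ∈ Ioc 0 ⌊Real.exp (t * L)⌋₊, c n) atTop (nhds t))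
    {h : ℝ → ℝ} (hh : UniformContinuous h) {R : ℝ} (hR : 0 < R) :
    Tendsto (fun L : ℝ => L⁻¹ * ∑ n ∈ Ioc 1 ⌊Real.exp (R * L)⌋₊, c n * h (Real.log n / L))
      atTop (nhds (∫ u in 0..R, h u)) := by
  rw [Metric.tendsto_nhds]
  intro ε hε
  set ε' := ε / (4 * R) with hε'
  have hε'0 : 0 < ε' := by positivity
  obtain ⟨δ, hδ, hhδ⟩ := Metric.uniformContinuous_iff.1 hh ε' hε'0
  obtain ⟨k, hk⟩ := exists_nat_gt (R / δ)
  have hk0 : (0 : ℝ) < k := lt_trans (by positivity) hk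
  have hkδ : R / k < δ := by
    rw [div_lt_iff₀ hδ] at hk
    rw [div_lt_iff₀ hk0]
    linarith
  set p : ℕ → ℝ := fun j => j * (R / k) with hp
  have hstep (j : ℕ) : p (j + 1) - p j = R / k := by simp only [hp]; push_cast; ring
  have hRk : 0 < R / k := by positivity
  have hp0 (j : ℕ) : 0 ≤ p j := by simp only [hp]; positivity
  have hev : ∀ᶠ L : ℝ in atTop, ∀ j ∈ range k,
      |L⁻¹ * ∑ n ∈ Ioc ⌊Real.exp (p j * L)⌋₊ ⌊Real.exp (p (j + 1) * L)⌋₊,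
        c n * h (Real.log n / L) - ∫ u in p j..p (j + 1), h u| < 3 * ε' * (p (j + 1) - p j) := by
    rw [eventually_all_finset]
    intro j _
    refine eventually_abs_sum_sub_integral_lt hc0 hc hh.continuous (y := h (p j)) (hp0 j)
      (by linarith [hstep j]) hε'0 fun u hu => ?_
    refine (hhδ ?_).le
    rw [Real.dist_eq, abs_of_nonneg (by linarith [hu.1])]
    linarith [hu.2, hstep j]
  filter_upwards [hev, eventually_gt_atTop 0] with L hL hL0
  have hpk : p k = R := by simp only [hp]; field_simp
  have hpz : p 0 = 0 := by simp [hp]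
  have hmono : Monotone fun j : ℕ => ⌊Real.exp (p j * L)⌋₊ := by
    refine monotone_nat_of_le_succ fun j => ?_
    have : p j ≤ p (j + 1) := by linarith [hstep j]
    gcongr
  have hS := sum_range_sum_Ioc (fun n => c n * h (Real.log n / L)) hmono k
  have hI := intervalIntegral.sum_integral_adjacent_intervals (f := h) (a := p) (n := k)
    (μ := MeasureTheory.volume) fun j _ => hh.continuous.intervalIntegrable _ _
  simp only [hpk, hpz, zero_mul, Real.exp_zero, Nat.floor_one] at hS hI
  rw [Real.dist_eq, ← hS, ← hI, mul_sum, ← sum_sub_distrib]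
  calc _ ≤ ∑ j ∈ range k, 3 * ε' * (p (j + 1) - p j) :=
        (abs_sum_le_sum_abs _ _).trans (sum_le_sum fun j hj => (hL j hj).le)
    _ = 3 / 4 * ε := by
        simp only [hstep, sum_const, card_range, nsmul_eq_mul, hε']
        field_simp
    _ < ε := by linarith

open ArithmeticFunction in
theorem summable_vonMangoldt_div_not_prime :
    Summable fun n : ℕ => (if n.Prime then 0 else Λ n) / (n : ℝ) := by
  have := vonMangoldt.summable_residueClass_non_primes_div (q := 1) 0
  convert this using 4 with n
  simp [vonMangoldt.residueClass, Set.indicator, Subsingleton.elim (n : ZMod 1) 0]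

open ArithmeticFunction in
theorem abs_vonMangoldt_sq_div_sub_le (n : ℕ) :
    |Λ n ^ 2 / n - Λ n / n * Real.log n| ≤
      (if n.Prime then 0 else Λ n) / (n : ℝ) * Real.log n := by
  split_ifs with hn
  · rw [vonMangoldt_apply_prime hn, pow_two, mul_div_right_comm, sub_self]
    simp
  · have h1 : Λ n ^ 2 / n - Λ n / n * Real.log n = -(Λ n / n * (Real.log n - Λ n)) := by ring
    have h0 : 0 ≤ Λ n / (n : ℝ) := div_nonneg vonMangoldt_nonneg n.cast_nonneg
    have h2 := vonMangoldt_le_log (n := n)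
    rw [h1, abs_neg, abs_of_nonneg (mul_nonneg h0 (by linarith))]
    exact mul_le_mul_of_nonneg_left (by linarith [vonMangoldt_nonneg (n := n)]) h0

open ArithmeticFunction Finset Filter in
/-- Replacing `Λ(n)²` by `Λ(n) log n` changes the weighted sums by `o(L²)`. -/
theorem tendsto_inv_sq_mul_sum_vonMangoldt_sq_sub {f : ℝ → ℝ} {M : ℝ} (hM : ∀ u, |f u| ≤ M)
    {R : ℝ} (hR : 0 < R) :
    Tendsto (fun L : ℝ => 1 / L ^ 2 * ∑ n ∈ Ioc 1 ⌊Real.exp (R * L)⌋₊,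
      (Λ n ^ 2 / n - Λ n / n * Real.log n) * f (Real.log n / L)) atTop (nhds 0) := by
  set e : ℕ → ℝ := fun n => (if n.Prime then 0 else Λ n) / (n : ℝ) with he
  have he0 (n : ℕ) : 0 ≤ e n := by
    simp only [he]
    split_ifs
    · simp
    · exact div_nonneg vonMangoldt_nonneg n.cast_nonneg
  have hM0 : 0 ≤ M := (abs_nonneg _).trans (hM 0)
  have hlim : Tendsto (fun L : ℝ => (R * M * ∑' n, e n) * L⁻¹) atTop (nhds 0) := by
    simpa using tendsto_inv_atTop_zero.const_mul (R * M * ∑' n, e n)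
  refine squeeze_zero_norm' ?_ hlim
  filter_upwards [eventually_gt_atTop 0] with L hL
  rw [Real.norm_eq_abs, abs_mul, abs_of_pos (by positivity : 0 < 1 / L ^ 2)]
  calc _ ≤ 1 / L ^ 2 * ∑ n ∈ Ioc 1 ⌊Real.exp (R * L)⌋₊, e n * (R * L) * M := by
        refine mul_le_mul_of_nonneg_left ?_ (by positivity)
        refine (abs_sum_le_sum_abs _ _).trans (sum_le_sum fun n hn => ?_)
        have hlog : Real.log n ≤ R * L := by
          have := (log_div_mem_Icc_of_mem_Ioc_floor_exp (a := 0) (b := R) hL (by simpa using hn)).2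
          rwa [div_le_iff₀ hL] at this
        rw [abs_mul]
        exact mul_le_mul ((abs_vonMangoldt_sq_div_sub_le n).trans
          (mul_le_mul_of_nonneg_left hlog (he0 n))) (hM _) (abs_nonneg _)
          (mul_nonneg (he0 n) (by positivity))
    _ = R * M * L⁻¹ * ∑ n ∈ Ioc 1 ⌊Real.exp (R * L)⌋₊, e n := by
        rw [← sum_mul, ← sum_mul]
        field_simp
    _ ≤ R * M * L⁻¹ * ∑' n, e n :=
        mul_le_mul_of_nonneg_left
          (summable_vonMangoldt_div_not_prime.sum_le_tsum _ fun n _ => he0 n) (by positivity)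
    _ = _ := by ring

open ArithmeticFunction Filter in
/-- For continuous compactly supported `g`, as `Q → ∞`,
`(1/(log Q)²) ∑ₙ Λ(n)²/n · g(log n / log Q)²` converges to `∫₀^∞ u g(u)² du`. -/
theorem vonMangoldt_squared_sum_limit (g : ℝ → ℝ) (hg : Continuous g)
    (hsupp : HasCompactSupport g) :
    Tendsto
      (fun Q : ℝ => (1 / (Real.log Q) ^ 2) *
        ∑' n : ℕ, Λ n ^ 2 / n * g (Real.log n / Real.log Q) ^ 2)
      atTop
      (nhds (∫ u in Set.Ioi (0 : ℝ), u * g u ^ 2)) := by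
  obtain ⟨R, hR, hgR⟩ : ∃ R : ℝ, 0 < R ∧ ∀ u, R < u → g u = 0 := by
    obtain ⟨R, hR, h⟩ := hsupp.exists_pos_le_norm
    exact ⟨R, hR, fun u hu => h u (hu.le.trans (le_abs_self u))⟩
  obtain ⟨B, hB⟩ := hg.bounded_above_of_compact_support hsupp
  have hM (u : ℝ) : |g u ^ 2| ≤ B ^ 2 := by
    rw [abs_pow]
    exact pow_le_pow_left₀ (abs_nonneg _) (hB u) 2
  have hh : UniformContinuous fun u => u * g u ^ 2 := by
    refine Continuous.uniformContinuous_of_tendsto_cocompact (by fun_prop)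
      (HasCompactSupport.is_zero_at_infty ?_)
    exact hsupp.mono fun u hu hgu => hu (by simp [hgu])
  have hint : ∫ u in Set.Ioi (0 : ℝ), u * g u ^ 2 = ∫ u in 0..R, u * g u ^ 2 := by
    rw [intervalIntegral.integral_of_le hR.le]
    refine MeasureTheory.setIntegral_eq_of_subset_of_forall_sdiff_eq_zero measurableSet_Ioi
      Set.Ioc_subset_Ioi_self fun u hu => ?_
    have : R < u := by
      by_contra hle
      exact hu.2 ⟨hu.1, not_lt.1 hle⟩
    simp [hgR u this]
  have hmain := (tendsto_inv_sq_mul_sum_vonMangoldt_sq_sub hM hR).add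
    (tendsto_inv_mul_sum_mul_comp_log_div (c := fun n : ℕ => Λ n / n)
      (fun n => div_nonneg vonMangoldt_nonneg n.cast_nonneg)
      (fun t ht => tendsto_inv_mul_sum_vonMangoldt_div ht) hh hR)
  rw [zero_add, ← hint] at hmain
  refine Tendsto.comp (g := fun L : ℝ => 1 / L ^ 2 *
    ∑' n : ℕ, Λ n ^ 2 / n * g (Real.log n / L) ^ 2) (hmain.congr' ?_) Real.tendsto_log_atTop
  filter_upwards [eventually_gt_atTop 0] with L hL
  rw [tsum_eq_sum (s := Finset.Ioc 1 ⌊Real.exp (R * L)⌋₊), Finset.mul_sum, Finset.mul_sum,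
    Finset.mul_sum, ← Finset.sum_add_distrib]
  · refine Finset.sum_congr rfl fun n _ => ?_
    field_simp
    ring
  · intro n hn
    rcases Nat.lt_or_ge 1 n with h1 | h1
    · have h2 : ⌊Real.exp (R * L)⌋₊ < n := by simpa [h1] using hn
      have hn0 : (0 : ℝ) < n := by positivity
      have h3 := (Real.lt_log_iff_exp_lt hn0).2 (Nat.lt_of_floor_lt h2)
      rw [hgR _ ((lt_div_iff₀ hL).2 h3)]
      simp
    · interval_cases n <;> simp
end
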